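/- Suppose α, β ∈ (0,π) and μ : ℕ → ℝ is a strictly increasing sequence enumerating precisely the eigenvalues of L(q,α,β), with normalized norming constants ãₙ = ∫₀^π φ̃ₙ(x)² dx and b̃ₙ = ∫₀^π ψ̃ₙ(x)² dx, where φ̃ₙ is the solution of −y'' + q y = μₙ y with φ̃ₙ(0) = 1, φ̃ₙ'(0) = −cot α, and ψ̃ₙ is the solution with ψ̃ₙ(π) = 1, ψ̃ₙ'(π) = −cot β. Then for every n ≥ 1, 1/b̃ₙ = ãₙ·n⁴ / (π²·(μ₀ − μₙ)²·(∏_{k≥1, k≠n} (μ_k − μₙ)/k²)²), the infinite product being convergent. -/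

import Mathlib

open Real MeasureTheory Set

noncomputable section

/-- `y` (with derivative `y'`) solves `-y'' + Q y = μ y` on `[0, π]`:
`y` is differentiable with derivative `y'`, and
`y' x = y' 0 + ∫ t in 0..x, (Q t - μ) * y t` for all `x ∈ [0, π]`. -/
def IsSol (Q : ℝ → ℝ) (μ : ℝ) (y y' : ℝ → ℝ) : Prop :=
  (∀ x ∈ Set.Icc (0 : ℝ) π, HasDerivAt y (y' x) x) ∧
  (∀ x ∈ Set.Icc (0 : ℝ) π, y' x = y' 0 + ∫ t in (0 : ℝ)..x, (Q t - μ) * y t)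

/-- `μ` is an eigenvalue of the Sturm–Liouville problem `L(Q, γ, δ)`. -/
def IsEigenvalue (Q : ℝ → ℝ) (γ δ : ℝ) (μ : ℝ) : Prop :=
  ∃ y y' : ℝ → ℝ, IsSol Q μ y y' ∧
    (∃ x ∈ Set.Icc (0 : ℝ) π, y x ≠ 0) ∧
    y 0 * Real.cos γ + y' 0 * Real.sin γ = 0 ∧
    y π * Real.cos δ + y' π * Real.sin δ = 0


lemma sl_ibp {x : ℝ} (hx : 0 ≤ x) {f v v' : ℝ → ℂ} (hf : IntervalIntegrable f volume 0 x)
    (hv : ∀ t ∈ Icc 0 x, HasDerivAt v (v' t) t) (hv' : ContinuousOn v' (Icc 0 x)) :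
    ∫ t in (0:ℝ)..x, f t * v t
      = (∫ t in (0:ℝ)..x, f t) * v x - ∫ t in (0:ℝ)..x, (∫ s in (0:ℝ)..t, f s) * v' t := by
  have hv'i : IntervalIntegrable v' volume 0 x :=
    ContinuousOn.intervalIntegrable (by rwa [uIcc_of_le hx])
  have hvc : ContinuousOn v (Icc 0 x) := fun t ht => (hv t ht).continuousAt.continuousWithinAt
  have hfv : IntervalIntegrable (fun t => f t * v t) volume 0 x :=
    hf.mul_continuousOn (by rwa [uIcc_of_le hx])
  have h1 : ∫ t in (0:ℝ)..x, f t * (v x - v t) = (∫ t in (0:ℝ)..x, f t) * v x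
      - ∫ t in (0:ℝ)..x, f t * v t := by
    simp_rw [mul_sub]
    rw [intervalIntegral.integral_sub (hf.mul_const _) hfv, intervalIntegral.integral_mul_const]
  have hswap := MeasureTheory.intervalIntegral_intervalIntegral_swap (a := 0) (b := x) (c := 0)
    (d := x) (F := fun s t => if t ≤ s then f t * v' s else 0) (by
      have h0 : Integrable (fun p : ℝ × ℝ => v' p.1 * f p.2)
          ((volume.restrict (uIoc 0 x)).prod (volume.restrict (uIoc 0 x))) := by
        apply Integrable.mul_prod (f := v') (g := f)
        · exact (intervalIntegrable_iff.1 hv'i)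
        · exact (intervalIntegrable_iff.1 hf)
      have h2 := h0.indicator (s := {p : ℝ × ℝ | p.2 ≤ p.1})
        (measurableSet_le measurable_snd measurable_fst)
      rw [Measure.prod_restrict] at h2
      refine h2.congr (Filter.Eventually.of_forall fun p => ?_)
      rcases p with ⟨s, t⟩
      by_cases h : t ≤ s
      · simp [Function.uncurry, h, mul_comm]
      · simp [Function.uncurry, h])
  have h3 : ∫ s in (0:ℝ)..x, ∫ t in (0:ℝ)..x, (if t ≤ s then f t * v' s else 0)
      = ∫ t in (0:ℝ)..x, (∫ s in (0:ℝ)..t, f s) * v' t := by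
    apply intervalIntegral.integral_congr
    intro s hs
    rw [uIcc_of_le hx] at hs
    simp only
    rw [intervalIntegral.integral_of_le hx, intervalIntegral.integral_of_le hs.1,
      ← integral_mul_const]
    have : (fun t => if t ≤ s then f t * v' s else 0) = (Iic s).indicator (fun t => f t * v' s) := by
      ext t; simp [indicator]
    rw [this, setIntegral_indicator measurableSet_Iic]
    congr 2
    ext t; simp only [mem_inter_iff, mem_Ioc, mem_Iic]
    constructor
    · rintro ⟨⟨a, b⟩, c⟩; exact ⟨a, c⟩
    · rintro ⟨a, b⟩; exact ⟨⟨a, b.trans hs.2⟩, b⟩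
  have h4 : ∫ t in (0:ℝ)..x, ∫ s in (0:ℝ)..x, (if t ≤ s then f t * v' s else 0)
      = ∫ t in (0:ℝ)..x, f t * (v x - v t) := by
    apply intervalIntegral.integral_congr
    intro t ht
    rw [uIcc_of_le hx] at ht
    simp only
    have h5 : ∫ s in t..x, v' s = v x - v t := by
      apply intervalIntegral.integral_eq_sub_of_hasDerivAt
      · intro s hs
        rw [uIcc_of_le ht.2] at hs
        exact hv s ⟨ht.1.trans hs.1, hs.2⟩
      · apply hv'i.mono_set
        rw [uIcc_of_le ht.2, uIcc_of_le hx]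
        exact Icc_subset_Icc_left ht.1
    rw [← h5, intervalIntegral.integral_of_le hx, intervalIntegral.integral_of_le ht.2,
      ← integral_const_mul, ← integral_Icc_eq_integral_Ioc, ← integral_Icc_eq_integral_Ioc]
    have : (fun s => if t ≤ s then f t * v' s else 0) = (Ici t).indicator (fun s => f t * v' s) := by
      ext s; simp [indicator]
    rw [this, setIntegral_indicator measurableSet_Ici]
    congr 2
    ext s; simp only [mem_inter_iff, mem_Icc, mem_Ici]
    constructor
    · rintro ⟨⟨a, b⟩, c⟩; exact ⟨c, b⟩
    · rintro ⟨a, b⟩; exact ⟨⟨ht.1.trans a, b⟩, a⟩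
  have h6 : ∫ t in (0:ℝ)..x, (∫ s in (0:ℝ)..t, f s) * v' t
      = ∫ t in (0:ℝ)..x, f t * (v x - v t) := by rw [← h3, ← h4]; exact hswap
  rw [h6, h1]; ring

/-- complex solutions of `y'' = p y` -/
def CSol (p : ℝ → ℂ) (y y' : ℝ → ℂ) : Prop :=
  (∀ x ∈ Icc (0 : ℝ) π, HasDerivAt y (y' x) x) ∧
  (∀ x ∈ Icc (0 : ℝ) π, y' x = y' 0 + ∫ t in (0 : ℝ)..x, p t * y t)

lemma sl_ii_mono {p : ℝ → ℂ} (hp : IntervalIntegrable p volume 0 π) {x : ℝ}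
    (hx : x ∈ Icc 0 π) : IntervalIntegrable p volume 0 x :=
  hp.mono_set (by rw [uIcc_of_le hx.1, uIcc_of_le pi_pos.le]; exact Icc_subset_Icc_right hx.2)

lemma CSol.cont {p y y'} (h : CSol p y y') : ContinuousOn y (Icc 0 π) :=
  fun t ht => (h.1 t ht).continuousAt.continuousWithinAt

lemma CSol.pint {p y y'} (h : CSol p y y') (hp : IntervalIntegrable p volume 0 π) :
    IntervalIntegrable (fun t => p t * y t) volume 0 π :=
  hp.mul_continuousOn (by rw [uIcc_of_le pi_pos.le]; exact h.cont)

lemma CSol.cont' {p y y'} (h : CSol p y y') (hp : IntervalIntegrable p volume 0 π) :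
    ContinuousOn y' (Icc 0 π) := by
  have h1 : ContinuousOn (fun x => y' 0 + ∫ t in (0 : ℝ)..x, p t * y t) (Icc 0 π) := by
    apply continuousOn_const.add
    have := intervalIntegral.continuousOn_primitive_interval' (h.pint hp) (a := 0) (by simp [pi_pos.le])
    rwa [uIcc_of_le pi_pos.le] at this
  exact h1.congr h.2

lemma CSol.green {p₁ p₂ y₁ y₁' : ℝ → ℂ} {y₂ y₂' : ℝ → ℂ} (h₁ : CSol p₁ y₁ y₁')
    (hp₁ : IntervalIntegrable p₁ volume 0 π) (hp₂ : IntervalIntegrable p₂ volume 0 π)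
    {x : ℝ} (hx : x ∈ Icc 0 π)
    (h₂ : ∀ t ∈ Icc 0 x, HasDerivAt y₂ (y₂' t) t)
    (h₂' : ∀ t ∈ Icc 0 x, y₂' t = y₂' 0 + ∫ s in (0:ℝ)..t, p₂ s * y₂ s) :
    y₁' x * y₂ x - y₁ x * y₂' x - (y₁' 0 * y₂ 0 - y₁ 0 * y₂' 0)
      = ∫ t in (0:ℝ)..x, (p₁ t - p₂ t) * (y₁ t * y₂ t) := by
  have hsub : Icc 0 x ⊆ Icc 0 π := Icc_subset_Icc_right hx.2
  have c2 : ContinuousOn y₂ (Icc 0 x) := fun t ht => (h₂ t ht).continuousAt.continuousWithinAt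
  have c1 : ContinuousOn y₁ (Icc 0 x) := h₁.cont.mono hsub
  have c1' : ContinuousOn y₁' (Icc 0 x) := (h₁.cont' hp₁).mono hsub
  have i1 := sl_ii_mono (h₁.pint hp₁) hx
  have i2 : IntervalIntegrable (fun t => p₂ t * y₂ t) volume 0 x :=
    (sl_ii_mono hp₂ hx).mul_continuousOn (by rwa [uIcc_of_le hx.1])
  have c2' : ContinuousOn y₂' (Icc 0 x) := by
    have h1 : ContinuousOn (fun x => y₂' 0 + ∫ t in (0 : ℝ)..x, p₂ t * y₂ t) (Icc 0 x) := by
      apply continuousOn_const.add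
      have := intervalIntegral.continuousOn_primitive_interval' i2 (a := 0) (by simp)
      rwa [uIcc_of_le hx.1] at this
    exact h1.congr h₂'
  have A := sl_ibp hx.1 i1 h₂ c2'
  have B := sl_ibp hx.1 i2 (fun t ht => h₁.1 t (hsub ht)) c1'
  have A' : ∫ t in (0:ℝ)..x, (∫ s in (0:ℝ)..t, p₁ s * y₁ s) * y₂' t
      = (∫ t in (0:ℝ)..x, y₁' t * y₂' t) - y₁' 0 * (y₂ x - y₂ 0) := by
    have : ∫ t in (0:ℝ)..x, y₂' t = y₂ x - y₂ 0 :=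
      intervalIntegral.integral_eq_sub_of_hasDerivAt (by rwa [uIcc_of_le hx.1])
        (ContinuousOn.intervalIntegrable (by rwa [uIcc_of_le hx.1]))
    rw [← this, ← intervalIntegral.integral_const_mul, ← intervalIntegral.integral_sub]
    · apply intervalIntegral.integral_congr
      intro t ht
      rw [uIcc_of_le hx.1] at ht
      simp only [h₁.2 t (hsub ht)]; ring
    · exact ContinuousOn.intervalIntegrable (by rw [uIcc_of_le hx.1]; exact c1'.mul c2')
    · exact ContinuousOn.intervalIntegrable (by rw [uIcc_of_le hx.1]; exact continuousOn_const.mul c2')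
  have B' : ∫ t in (0:ℝ)..x, (∫ s in (0:ℝ)..t, p₂ s * y₂ s) * y₁' t
      = (∫ t in (0:ℝ)..x, y₁' t * y₂' t) - y₂' 0 * (y₁ x - y₁ 0) := by
    have : ∫ t in (0:ℝ)..x, y₁' t = y₁ x - y₁ 0 :=
      intervalIntegral.integral_eq_sub_of_hasDerivAt (by
        rw [uIcc_of_le hx.1]; exact fun t ht => h₁.1 t (hsub ht))
        (ContinuousOn.intervalIntegrable (by rwa [uIcc_of_le hx.1]))
    rw [← this, ← intervalIntegral.integral_const_mul, ← intervalIntegral.integral_sub]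
    · apply intervalIntegral.integral_congr
      intro t ht
      rw [uIcc_of_le hx.1] at ht
      simp only [h₂' t ht]; ring
    · exact ContinuousOn.intervalIntegrable (by rw [uIcc_of_le hx.1]; exact c1'.mul c2')
    · exact ContinuousOn.intervalIntegrable (by rw [uIcc_of_le hx.1]; exact continuousOn_const.mul c1')
  have e1 := h₁.2 x hx
  have e2 := h₂' x (right_mem_Icc.2 hx.1)
  have C : ∫ t in (0:ℝ)..x, (p₁ t - p₂ t) * (y₁ t * y₂ t)
      = (∫ t in (0:ℝ)..x, p₁ t * y₁ t * y₂ t) - ∫ t in (0:ℝ)..x, p₂ t * y₂ t * y₁ t := by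
    rw [← intervalIntegral.integral_sub]
    · congr 1; ext t; ring
    · exact i1.mul_continuousOn (by rwa [uIcc_of_le hx.1])
    · exact i2.mul_continuousOn (by rwa [uIcc_of_le hx.1])
  rw [C, A, B, A', B']
  have e1' : (∫ t in (0:ℝ)..x, p₁ t * y₁ t) = y₁' x - y₁' 0 := by rw [e1]; ring
  have e2' : (∫ t in (0:ℝ)..x, p₂ t * y₂ t) = y₂' x - y₂' 0 := by rw [e2]; ring
  rw [e1', e2']; ring


abbrev SX := C(Icc (0 : ℝ) π, ℂ)

def slE (f : SX) : ℝ → ℂ := IccExtend pi_pos.le f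

lemma slE_cont (f : SX) : Continuous (slE f) := f.continuous.Icc_extend'

lemma slE_of_mem (f : SX) {x : ℝ} (hx : x ∈ Icc 0 π) : slE f x = f ⟨x, hx⟩ :=
  IccExtend_of_mem _ _ hx

lemma slE_norm (f : SX) (x : ℝ) : ‖slE f x‖ ≤ ‖f‖ := f.norm_coe_le_norm _

lemma slE_pint {p : ℝ → ℂ} (hp : IntervalIntegrable p volume 0 π) (f : SX) :
    IntervalIntegrable (fun t => p t * slE f t) volume 0 π :=
  hp.mul_continuousOn (slE_cont f).continuousOn

lemma sl_int_norm_le {f : ℝ → ℂ} {g : ℝ → ℝ} {x : ℝ} (hx : 0 ≤ x)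
    (hg : IntervalIntegrable g volume 0 x)
    (h : ∀ t ∈ Icc 0 x, ‖f t‖ ≤ g t) : ‖∫ t in (0:ℝ)..x, f t‖ ≤ ∫ t in (0:ℝ)..x, g t := by
  apply intervalIntegral.norm_integral_le_of_norm_le hx _ hg
  exact Filter.Eventually.of_forall fun t ht => h t (Ioc_subset_Icc_self ht)

lemma sl_int_mono {p : ℝ → ℂ} (hp : IntervalIntegrable p volume 0 π) {x : ℝ} (hx : x ∈ Icc 0 π) :
    ∫ t in (0:ℝ)..x, ‖p t‖ ≤ ∫ t in (0:ℝ)..π, ‖p t‖ := by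
  apply intervalIntegral.integral_mono_interval le_rfl hx.1 hx.2 _ hp.norm
  exact Filter.Eventually.of_forall fun t => norm_nonneg _

lemma sl_restr_cont {f : ℝ → ℂ} (h : ContinuousOn f (Icc 0 π)) :
    Continuous (fun x : Icc (0:ℝ) π => f x) := continuousOn_iff_continuous_domRestrict.1 h

/-- the integration operator `f ↦ ∫₀ˣ p f` -/
def slP (p : ℝ → ℂ) (hp : IntervalIntegrable p volume 0 π) : SX →L[ℂ] SX :=
  LinearMap.mkContinuous
    { toFun := fun f => ⟨fun x => ∫ t in (0:ℝ)..x, p t * slE f t, by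
        have := intervalIntegral.continuousOn_primitive_interval' (slE_pint hp f) (a := 0)
          (by simp [pi_pos.le])
        rw [uIcc_of_le pi_pos.le] at this
        exact sl_restr_cont this⟩
      map_add' := fun f g => by
        ext x
        change ∫ t in (0:ℝ)..x, p t * slE (f + g) t = (∫ t in (0:ℝ)..x, p t * slE f t) + ∫ t in (0:ℝ)..x, p t * slE g t
        rw [← intervalIntegral.integral_add (sl_ii_mono (slE_pint hp f) x.2)
          (sl_ii_mono (slE_pint hp g) x.2)]
        congr 1; ext t
        simp [slE, IccExtend, mul_add]
      map_smul' := fun c f => by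
        ext x
        change ∫ t in (0:ℝ)..x, p t * slE (c • f) t = c * ∫ t in (0:ℝ)..x, p t * slE f t
        rw [← intervalIntegral.integral_const_mul]
        congr 1; ext t
        simp [slE, IccExtend]; ring }
    (∫ t in (0:ℝ)..π, ‖p t‖) (fun f => by
      rw [ContinuousMap.norm_le _ (mul_nonneg (intervalIntegral.integral_nonneg pi_pos.le
        (fun _ _ => norm_nonneg _)) (norm_nonneg _))]
      intro x
      change ‖∫ t in (0:ℝ)..x, p t * slE f t‖ ≤ _
      refine (sl_int_norm_le x.2.1 ((sl_ii_mono hp x.2).norm.mul_const ‖f‖) (fun t ht => ?_)).trans ?_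
      · rw [norm_mul]
        exact mul_le_mul_of_nonneg_left (slE_norm f t) (norm_nonneg _)
      · rw [intervalIntegral.integral_mul_const]
        exact mul_le_mul_of_nonneg_right (sl_int_mono hp x.2) (norm_nonneg _))

lemma slP_apply (p : ℝ → ℂ) (hp) (f : SX) (x : Icc (0:ℝ) π) :
    slP p hp f x = ∫ t in (0:ℝ)..x, p t * slE f t := rfl

lemma sl_one_int : IntervalIntegrable (fun _ : ℝ => (1 : ℂ)) volume 0 π := intervalIntegrable_const

def slJ : SX →L[ℂ] SX := slP (fun _ => 1) sl_one_int

lemma slJ_apply (f : SX) (x : Icc (0:ℝ) π) :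
    slJ f x = ∫ t in (0:ℝ)..x, slE f t := by simp [slJ, slP_apply]

def slM (κ : ℝ) : SX →L[ℂ] SX :=
  ContinuousLinearMap.mul ℂ SX ⟨fun x => Complex.exp (κ * (x : ℝ)), by fun_prop⟩

lemma slM_apply (κ : ℝ) (f : SX) (x : Icc (0:ℝ) π) :
    slM κ f x = Complex.exp (κ * (x : ℝ)) * f x := rfl

lemma slM_mul (κ : ℝ) : slM κ * slM (-κ) = 1 := by
  ext f x
  simp [slM_apply, ← mul_assoc, ← Complex.exp_add]

lemma sl_norm_exp (κ x : ℝ) : ‖Complex.exp (κ * x)‖ = Real.exp (κ * x) := by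
  rw [Complex.norm_exp]; simp

lemma sl_ring {R : Type*} [Ring R] (a b t : R) :
    a * (1 - b * t * a) * b = a * b - (a * b) * t * (a * b) := by noncomm_ring

lemma sl_unit (p : ℝ → ℂ) (hp : IntervalIntegrable p volume 0 π) :
    IsUnit (1 - slJ * slP p hp) := by
  set c := ∫ t in (0:ℝ)..π, ‖p t‖ with hc
  have hc0 : 0 ≤ c := intervalIntegral.integral_nonneg pi_pos.le (fun _ _ => norm_nonneg _)
  set κ := c + 1 with hκ
  have hκ0 : 0 < κ := by positivity
  have key : ‖slM (-κ) * (slJ * slP p hp) * slM κ‖ ≤ c / κ := by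
    apply ContinuousLinearMap.opNorm_le_bound _ (by positivity)
    intro f
    rw [ContinuousMap.norm_le _ (by positivity)]
    intro x
    change ‖Complex.exp ((-κ : ℝ) * (x : ℝ)) * (slJ (slP p hp (slM κ f)) x)‖ ≤ _
    have h1 : ∀ s : Icc (0:ℝ) π, ‖slP p hp (slM κ f) s‖ ≤ c * ‖f‖ * Real.exp (κ * s) := by
      intro s
      rw [slP_apply]
      refine (sl_int_norm_le s.2.1 ((sl_ii_mono hp s.2).norm.mul_const (‖f‖ * Real.exp (κ * s)))
        (fun t ht => ?_)).trans ?_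
      · have ht' : t ∈ Icc 0 π := ⟨ht.1, ht.2.trans s.2.2⟩
        rw [norm_mul, slE_of_mem _ ht', slM_apply, norm_mul, sl_norm_exp, mul_comm ‖f‖]
        gcongr
        · exact ht.2
        · exact f.norm_coe_le_norm _
      · rw [intervalIntegral.integral_mul_const, mul_assoc]
        exact mul_le_mul_of_nonneg_right (sl_int_mono hp s.2) (by positivity)
    rw [norm_mul, slJ_apply, sl_norm_exp]
    have h2 : ‖∫ t in (0:ℝ)..x, slE (slP p hp (slM κ f)) t‖
        ≤ ∫ t in (0:ℝ)..x, c * ‖f‖ * Real.exp (κ * t) := by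
      apply sl_int_norm_le x.2.1
      · exact Continuous.intervalIntegrable (by fun_prop) _ _
      · intro t ht
        rw [slE_of_mem _ (⟨ht.1, ht.2.trans x.2.2⟩ : t ∈ Icc 0 π)]
        exact h1 _
    have h3 : ∫ t in (0:ℝ)..x, c * ‖f‖ * Real.exp (κ * t)
        = c * ‖f‖ * ((Real.exp (κ * x) - 1) / κ) := by
      rw [intervalIntegral.integral_const_mul, intervalIntegral.integral_comp_mul_left _ hκ0.ne',
        integral_exp]
      simp; ring_nf; simp
    rw [h3] at h2
    refine (mul_le_mul_of_nonneg_left h2 (Real.exp_pos _).le).trans ?_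
    have h4 : Real.exp (-κ * x) * Real.exp (κ * x) = 1 := by rw [← Real.exp_add]; simp
    have h5 : Real.exp (-κ * x) * (c * ‖f‖ * ((Real.exp (κ * x) - 1) / κ))
        = c / κ * ‖f‖ * (Real.exp (-κ * x) * Real.exp (κ * x) - Real.exp (-κ * x)) := by ring
    rw [h5, h4]
    have h6 : 0 < Real.exp (-κ * x) := Real.exp_pos _
    have : 0 ≤ c / κ * ‖f‖ := by positivity
    nlinarith
  have h1 := isUnit_one_sub_of_norm_lt_one (R := SX →L[ℂ] SX)
    (x := slM (-κ) * (slJ * slP p hp) * slM κ) (key.trans_lt (by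
    rw [div_lt_one hκ0]; linarith))
  have a1 := slM_mul κ
  have a2 : slM (-κ) * slM κ = 1 := by simpa using slM_mul (-κ)
  have u1 : IsUnit (slM κ) := ⟨⟨_, _, a1, a2⟩, rfl⟩
  have u2 : IsUnit (slM (-κ)) := ⟨⟨_, _, a2, a1⟩, rfl⟩
  have := (u1.mul h1).mul u2
  convert this using 1
  have : slM κ * (1 - slM (-κ) * (slJ * slP p hp) * slM κ) * slM (-κ)
    = slM κ * slM (-κ) - (slM κ * slM (-κ)) * (slJ * slP p hp) * (slM κ * slM (-κ)) :=
    sl_ring (R := SX →L[ℂ] SX) (slM κ) (slM (-κ)) (slJ * slP p hp)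
  rw [this, a1]; simp

def slLin (c d : ℂ) : SX := ⟨fun x => c + d * ((x : ℝ) : ℂ), by fun_prop⟩

lemma CSol.fix {p y y'} (h : CSol p y y') (hp : IntervalIntegrable p volume 0 π) (f : SX)
    (hf : ∀ x : Icc (0:ℝ) π, f x = y x) :
    (1 - slJ * slP p hp) f = slLin (y 0) (y' 0) := by
  ext x
  simp only [sub_apply, ContinuousMap.sub_apply]
  change f x - slJ (slP p hp f) x = y 0 + y' 0 * ((x:ℝ) : ℂ)
  rw [slJ_apply]
  have h1 : ∀ t ∈ Icc 0 (x : ℝ), slE (slP p hp f) t = y' t - y' 0 := by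
    intro t ht
    have ht' : t ∈ Icc 0 π := ⟨ht.1, ht.2.trans x.2.2⟩
    rw [slE_of_mem _ ht', slP_apply, h.2 t ht', add_sub_cancel_left]
    apply intervalIntegral.integral_congr
    intro s hs
    simp only at hs
    rw [uIcc_of_le ht.1] at hs
    have hs' : s ∈ Icc 0 π := ⟨hs.1, hs.2.trans ht'.2⟩
    simp only [slE_of_mem _ hs', hf]
  have h2 : ∫ t in (0:ℝ)..x, slE (slP p hp f) t = ∫ t in (0:ℝ)..x, (y' t - y' 0) := by
    apply intervalIntegral.integral_congr
    intro t ht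
    rw [uIcc_of_le x.2.1] at ht
    exact h1 t ht
  have hy' : IntervalIntegrable y' volume 0 x :=
    sl_ii_mono (ContinuousOn.intervalIntegrable (by rw [uIcc_of_le pi_pos.le]; exact h.cont' hp)) x.2
  rw [h2, intervalIntegral.integral_sub hy' (by simp),
    intervalIntegral.integral_eq_sub_of_hasDerivAt (f := y) _ hy', hf]
  · simp; ring
  · intro t ht
    rw [uIcc_of_le x.2.1] at ht
    exact h.1 t ⟨ht.1, ht.2.trans x.2.2⟩

/-- uniqueness -/
lemma CSol.uniq {p y y' u u'} (h : CSol p y y') (hu : CSol p u u')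
    (hp : IntervalIntegrable p volume 0 π) (c : ℂ) (h0 : u 0 = c * y 0) (h0' : u' 0 = c * y' 0) :
    ∀ x ∈ Icc (0:ℝ) π, u x = c * y x ∧ u' x = c * y' x := by
  let f : SX := ⟨fun x => y x, sl_restr_cont h.cont⟩
  let g : SX := ⟨fun x => u x, sl_restr_cont hu.cont⟩
  have e1 := h.fix hp f (fun _ => rfl)
  have e2 := hu.fix hp g (fun _ => rfl)
  have e3 : slLin (u 0) (u' 0) = c • slLin (y 0) (y' 0) := by
    ext x; rw [h0, h0']; simp [slLin]; ring
  rw [e3, ← e1, ← map_smul] at e2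
  obtain ⟨w, hw⟩ := sl_unit p hp
  have e4 : g = c • f := by
    have e5 := congrArg (fun z => (↑w⁻¹ : SX →L[ℂ] SX) z) e2
    simp only [← hw] at e5
    have : ∀ z, (↑w⁻¹ : SX →L[ℂ] SX) ((↑w : SX →L[ℂ] SX) z) = z := fun z => by
      have := w.inv_mul
      rw [← mul_apply_eq_comp, this]; rfl
    rwa [this, this] at e5
  have e6 : ∀ x ∈ Icc (0:ℝ) π, u x = c * y x := fun x hx => by
    have := congrArg (fun z : SX => z ⟨x, hx⟩) e4
    exact this
  intro x hx
  refine ⟨e6 x hx, ?_⟩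
  rw [hu.2 x hx, h.2 x hx, h0', mul_add, ← intervalIntegral.integral_const_mul]
  congr 1
  apply intervalIntegral.integral_congr
  intro t ht
  rw [uIcc_of_le hx.1] at ht
  simp only [e6 t ⟨ht.1, ht.2.trans hx.2⟩]; ring

lemma sl_pq {q : ℝ → ℂ} (hq : IntervalIntegrable q volume 0 π) (l : ℂ) :
    IntervalIntegrable (fun t => q t - l) volume 0 π := hq.sub (by simp)

lemma slP_sub {q : ℝ → ℂ} (hq : IntervalIntegrable q volume 0 π) (l : ℂ) :
    slP (fun t => q t - l) (sl_pq hq l) = slP q hq - l • slJ := by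
  ext f x
  simp only [sub_apply, smul_apply, ContinuousMap.sub_apply, ContinuousMap.smul_apply, slP_apply,
    slJ_apply]
  rw [smul_eq_mul, ← intervalIntegral.integral_const_mul, ← intervalIntegral.integral_sub]
  · congr 1; ext t; ring
  · exact sl_ii_mono (slE_pint hq f) x.2
  · exact ((slE_cont f).intervalIntegrable _ _).const_mul _

/-- the solution as an element of `SX` -/
def slF (q : ℝ → ℂ) (hq : IntervalIntegrable q volume 0 π) (h : ℂ) (l : ℂ) : SX :=
  Ring.inverse (1 - slJ * (slP q hq - l • slJ)) (slLin 1 h)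

lemma sl_inv_diff {R : Type*} [NormedRing R] [NormedAlgebra ℂ R] [CompleteSpace R] (a b c : R)
    (l : ℂ) (hu : IsUnit (1 - a * (b - l • c))) :
    DifferentiableAt ℂ (fun l : ℂ => Ring.inverse (1 - a * (b - l • c))) l := by
  have h0 : DifferentiableAt ℂ (fun l : ℂ => l • c) l := differentiableAt_id.smul_const c
  have h1 : DifferentiableAt ℂ (fun l : ℂ => 1 - a * (b - l • c)) l :=
    ((h0.const_sub b).const_mul a).const_sub 1
  exact (differentiableAt_inverse (𝕜 := ℂ) (R := R) hu).comp l h1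

lemma slF_diff (q : ℝ → ℂ) (hq : IntervalIntegrable q volume 0 π) (h : ℂ) :
    Differentiable ℂ (slF q hq h) := by
  intro l
  have hu : IsUnit (1 - slJ * (slP q hq - l • slJ)) := by
    rw [← slP_sub hq l]; exact sl_unit _ _
  have h2 := sl_inv_diff (R := SX →L[ℂ] SX) slJ (slP q hq) slJ l hu
  exact h2.clm_apply (differentiableAt_const (slLin 1 h))

def slY (q : ℝ → ℂ) (hq : IntervalIntegrable q volume 0 π) (h : ℂ) (l : ℂ) (x : ℝ) : ℂ :=
  1 + h * x + ∫ t in (0:ℝ)..x, slE ((slP q hq - l • slJ) (slF q hq h l)) t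

def slY' (q : ℝ → ℂ) (hq : IntervalIntegrable q volume 0 π) (h : ℂ) (l : ℂ) (x : ℝ) : ℂ :=
  h + slE ((slP q hq - l • slJ) (slF q hq h l)) x

lemma slY_eq (q : ℝ → ℂ) (hq : IntervalIntegrable q volume 0 π) (h : ℂ) (l : ℂ) {x : ℝ}
    (hx : x ∈ Icc 0 π) : slY q hq h l x = slF q hq h l ⟨x, hx⟩ := by
  have hu : IsUnit (1 - slJ * (slP q hq - l • slJ)) := by
    rw [← slP_sub hq l]; exact sl_unit _ _
  have h1 : (1 - slJ * (slP q hq - l • slJ)) (slF q hq h l) = slLin 1 h := by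
    rw [slF, ← mul_apply_eq_comp, Ring.mul_inverse_cancel _ hu]; rfl
  have h2 := congrArg (fun z : SX => z ⟨x, hx⟩) h1
  change slF q hq h l ⟨x, hx⟩ - slJ ((slP q hq - l • slJ) (slF q hq h l)) ⟨x, hx⟩ = 1 + h * (x:ℂ) at h2
  rw [slJ_apply] at h2
  rw [slY, ← h2]; ring

lemma slY_csol (q : ℝ → ℂ) (hq : IntervalIntegrable q volume 0 π) (h : ℂ) (l : ℂ) :
    CSol (fun t => q t - l) (slY q hq h l) (slY' q hq h l) := by
  constructor
  · intro x _
    have h1 := intervalIntegral.integral_hasDerivAt_right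
      ((slE_cont ((slP q hq - l • slJ) (slF q hq h l))).intervalIntegrable 0 x)
      ((slE_cont _).stronglyMeasurableAtFilter _ _) (slE_cont _).continuousAt
    have h2 : HasDerivAt (fun x : ℝ => (1 + h * (x:ℂ))) h x := by
      simpa using (Complex.ofRealCLM.hasDerivAt (x := x)).const_mul h |>.const_add 1
    exact h2.add h1
  · intro x hx
    have h0 : slY' q hq h l 0 = h := by
      rw [slY', slE_of_mem _ (⟨le_rfl, pi_pos.le⟩ : (0:ℝ) ∈ Icc 0 π), ← slP_sub, slP_apply]; simp
    rw [h0, slY', slE_of_mem _ hx, ← slP_sub, slP_apply]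
    congr 1
    apply intervalIntegral.integral_congr
    intro t ht
    simp only at ht
    rw [uIcc_of_le hx.1] at ht
    have ht' : t ∈ Icc 0 π := ⟨ht.1, ht.2.trans hx.2⟩
    simp only [slE_of_mem _ ht', slY_eq _ _ _ _ ht']

lemma slY_zero (q : ℝ → ℂ) (hq : IntervalIntegrable q volume 0 π) (h : ℂ) (l : ℂ) :
    slY q hq h l 0 = 1 := by simp [slY]

lemma slY'_zero (q : ℝ → ℂ) (hq : IntervalIntegrable q volume 0 π) (h : ℂ) (l : ℂ) :
    slY' q hq h l 0 = h := by
  rw [slY', slE_of_mem _ (⟨le_rfl, pi_pos.le⟩ : (0:ℝ) ∈ Icc 0 π), ← slP_sub, slP_apply]; simp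

/-- characteristic function -/
def slW (q : ℝ → ℂ) (hq : IntervalIntegrable q volume 0 π) (h H : ℂ) (l : ℂ) : ℂ :=
  slY' q hq h l π + H * slY q hq h l π

lemma slF_app_diff (q : ℝ → ℂ) (hq : IntervalIntegrable q volume 0 π) (h : ℂ) (x : Icc (0:ℝ) π) :
    Differentiable ℂ (fun l => slF q hq h l x) :=
  (ContinuousMap.evalCLM ℂ x : SX →L[ℂ] ℂ).differentiable.comp (slF_diff q hq h)

lemma slW_diff (q : ℝ → ℂ) (hq : IntervalIntegrable q volume 0 π) (h H : ℂ) :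
    Differentiable ℂ (slW q hq h H) := by
  have hm : π ∈ Icc 0 π := ⟨pi_pos.le, le_rfl⟩
  have e : slW q hq h H = fun l => h + (slP q hq (slF q hq h l) ⟨π, hm⟩ -
      l * slJ (slF q hq h l) ⟨π, hm⟩) + H * slF q hq h l ⟨π, hm⟩ := by
    ext l
    rw [slW, slY_eq _ _ _ _ hm, slY', slE_of_mem _ hm]; rfl
  rw [e]
  have a1 : Differentiable ℂ (fun l => slP q hq (slF q hq h l) ⟨π, hm⟩) :=
    ((ContinuousMap.evalCLM ℂ ⟨π, hm⟩ : SX →L[ℂ] ℂ).comp (slP q hq)).differentiable.comp (slF_diff q hq h)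
  have a2 : Differentiable ℂ (fun l => slJ (slF q hq h l) ⟨π, hm⟩) :=
    ((ContinuousMap.evalCLM ℂ ⟨π, hm⟩ : SX →L[ℂ] ℂ).comp slJ).differentiable.comp (slF_diff q hq h)
  have a3 := slF_app_diff q hq h ⟨π, hm⟩
  exact ((a1.sub (differentiable_id.mul a2)).const_add h).add (a3.const_mul H)


lemma sl_pi_mem : π ∈ Icc 0 π := ⟨pi_pos.le, le_rfl⟩

lemma slW_cross (q : ℝ → ℂ) (hq : IntervalIntegrable q volume 0 π) (h H l m : ℂ) :
    slW q hq h H l * slY q hq h m π - slY q hq h l π * slW q hq h H m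
      = (m - l) * ∫ t in (0:ℝ)..π, slY q hq h l t * slY q hq h m t := by
  have g := (slY_csol q hq h l).green (sl_pq hq l) (sl_pq hq m) sl_pi_mem
    (slY_csol q hq h m).1 (slY_csol q hq h m).2
  rw [slY_zero, slY'_zero, slY_zero, slY'_zero] at g
  have e : ∫ t in (0:ℝ)..π, (q t - l - (q t - m)) * (slY q hq h l t * slY q hq h m t)
      = (m - l) * ∫ t in (0:ℝ)..π, slY q hq h l t * slY q hq h m t := by
    rw [← intervalIntegral.integral_const_mul]
    congr 1; ext t; ring
  rw [e] at g
  rw [← g, slW, slW]; ring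

lemma CSol.conj {p y y'} (h : CSol p y y') :
    CSol (fun t => starRingEnd ℂ (p t)) (fun t => starRingEnd ℂ (y t))
      (fun t => starRingEnd ℂ (y' t)) := by
  constructor
  · intro x hx
    exact (Complex.conjCLE.toContinuousLinearMap.hasFDerivAt.comp_hasDerivAt x (h.1 x hx))
  · intro x hx
    beta_reduce
    rw [h.2 x hx, map_add]
    congr 1
    simp only [intervalIntegral, map_sub, ← integral_conj, map_mul]

abbrev slC (q : ℝ → ℝ) : ℝ → ℂ := fun t => (q t : ℂ)

lemma slY_conj (q : ℝ → ℝ) (hq : IntervalIntegrable (slC q) volume 0 π) (h : ℝ) (l : ℂ) :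
    ∀ x ∈ Icc (0:ℝ) π, slY (slC q) hq h (starRingEnd ℂ l) x = starRingEnd ℂ (slY (slC q) hq h l x) ∧
      slY' (slC q) hq h (starRingEnd ℂ l) x = starRingEnd ℂ (slY' (slC q) hq h l x) := by
  have h1 := (slY_csol (slC q) hq h l).conj
  have h2 : (fun t => starRingEnd ℂ (slC q t - l)) = fun t => slC q t - starRingEnd ℂ l := by
    ext t; simp
  rw [h2] at h1
  have := h1.uniq (slY_csol (slC q) hq h (starRingEnd ℂ l)) (sl_pq hq _) 1
    (by simp [slY_zero]) (by simp [slY'_zero])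
  intro x hx
  simpa using this x hx

lemma slY_cont (q : ℝ → ℂ) (hq : IntervalIntegrable q volume 0 π) (h l : ℂ) :
    ContinuousOn (slY q hq h l) (Icc 0 π) := (slY_csol q hq h l).cont

lemma slY_sq_pos (q : ℝ → ℂ) (hq : IntervalIntegrable q volume 0 π) (h l : ℂ) :
    0 < ∫ t in (0:ℝ)..π, ‖slY q hq h l t‖ ^ 2 := by
  apply intervalIntegral.integral_pos pi_pos
  · exact ((slY_cont q hq h l).norm.pow 2)
  · intro t _; positivity
  · exact ⟨0, ⟨le_rfl, pi_pos.le⟩, by simp [slY_zero]⟩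

lemma slW_conj (q : ℝ → ℝ) (hq : IntervalIntegrable (slC q) volume 0 π) (h H : ℝ) (l : ℂ) :
    slW (slC q) hq h H (starRingEnd ℂ l) = starRingEnd ℂ (slW (slC q) hq h H l) := by
  have := slY_conj q hq h l π sl_pi_mem
  simp [slW, this.1, this.2]

lemma slW_zero_real (q : ℝ → ℝ) (hq : IntervalIntegrable (slC q) volume 0 π) (h H : ℝ) (l : ℂ)
    (hl : slW (slC q) hq h H l = 0) : l = (l.re : ℂ) := by
  have h1 := slW_cross (slC q) hq h H l (starRingEnd ℂ l)
  rw [slW_conj, hl] at h1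
  have h2 : ∫ t in (0:ℝ)..π, slY (slC q) hq h l t * slY (slC q) hq h (starRingEnd ℂ l) t
      = ((∫ t in (0:ℝ)..π, ‖slY (slC q) hq h l t‖ ^ 2 : ℝ) : ℂ) := by
    rw [← intervalIntegral.integral_ofReal]
    apply intervalIntegral.integral_congr
    intro t ht
    rw [uIcc_of_le pi_pos.le] at ht
    simp only [(slY_conj q hq h l t ht).1, Complex.mul_conj, Complex.normSq_eq_norm_sq]
  rw [h2] at h1
  simp only [zero_mul, map_zero, mul_zero, sub_zero] at h1
  rcases mul_eq_zero.1 h1.symm with h3 | h3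
  · exact (Complex.conj_eq_iff_re.1 (sub_eq_zero.1 h3)).symm
  · exact absurd (Complex.ofReal_eq_zero.1 h3) (slY_sq_pos _ hq h l).ne'

lemma slW_deriv (q : ℝ → ℂ) (hq : IntervalIntegrable q volume 0 π) (h H l : ℂ)
    (hl : slW q hq h H l = 0) :
    - slY q hq h l π * deriv (slW q hq h H) l = ∫ t in (0:ℝ)..π, slY q hq h l t ^ 2 := by
  have hi : IntervalIntegrable (slY q hq h l) volume 0 π :=
    ContinuousOn.intervalIntegrable (by rw [uIcc_of_le pi_pos.le]; exact slY_cont q hq h l)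
  let G : ℂ → ℂ := fun m => slP (slY q hq h l) hi (slF q hq h m) ⟨π, sl_pi_mem⟩
  have hG : Differentiable ℂ G :=
    ((ContinuousMap.evalCLM ℂ ⟨π, sl_pi_mem⟩ : SX →L[ℂ] ℂ).comp (slP (slY q hq h l) hi)).differentiable.comp
      (slF_diff q hq h)
  have hGe : ∀ m, G m = ∫ t in (0:ℝ)..π, slY q hq h l t * slY q hq h m t := by
    intro m
    simp only [G, slP_apply]
    apply intervalIntegral.integral_congr
    intro t ht
    rw [uIcc_of_le pi_pos.le] at ht
    simp only [slE_of_mem _ ht, slY_eq q hq h m ht]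
  have e : (fun m => - slY q hq h l π * slW q hq h H m) = fun m => (m - l) * G m := by
    ext m
    rw [hGe, ← slW_cross q hq h H l m, hl]; ring
  have d1 : HasDerivAt (fun m => - slY q hq h l π * slW q hq h H m)
      (- slY q hq h l π * deriv (slW q hq h H) l) l :=
    ((slW_diff q hq h H l).hasDerivAt).const_mul _
  have d2 : HasDerivAt (fun m => (m - l) * G m) (1 * G l + (l - l) * deriv G l) l :=
    ((hasDerivAt_id l).sub_const l).mul (hG l).hasDerivAt
  rw [e] at d1
  rw [d1.unique d2, hGe]; simp [sq]

lemma slY_real_im (q : ℝ → ℝ) (hq : IntervalIntegrable (slC q) volume 0 π) (h : ℝ) (l : ℝ)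
    {x : ℝ} (hx : x ∈ Icc 0 π) :
    slY (slC q) hq h l x = ((slY (slC q) hq h l x).re : ℂ) ∧
    slY' (slC q) hq h l x = ((slY' (slC q) hq h l x).re : ℂ) := by
  have := slY_conj q hq h l x hx
  rw [Complex.conj_ofReal] at this
  exact ⟨(Complex.conj_eq_iff_re.1 this.1.symm).symm, (Complex.conj_eq_iff_re.1 this.2.symm).symm⟩

lemma slW_deriv_ne (q : ℝ → ℝ) (hq : IntervalIntegrable (slC q) volume 0 π) (h H : ℝ) (l : ℂ)
    (hl : slW (slC q) hq h H l = 0) : deriv (slW (slC q) hq h H) l ≠ 0 := by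
  obtain ⟨r, rfl⟩ : ∃ r : ℝ, l = r := ⟨_, slW_zero_real q hq h H l hl⟩
  intro h0
  have h1 := slW_deriv (slC q) hq h H r hl
  rw [h0, mul_zero] at h1
  have h2 : ∫ t in (0:ℝ)..π, slY (slC q) hq h r t ^ 2
      = ((∫ t in (0:ℝ)..π, ‖slY (slC q) hq h r t‖ ^ 2 : ℝ) : ℂ) := by
    rw [← intervalIntegral.integral_ofReal]
    apply intervalIntegral.integral_congr
    intro t ht
    rw [uIcc_of_le pi_pos.le] at ht
    simp only
    rw [(slY_real_im q hq h r ht).1, Complex.norm_real]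
    norm_cast
    simp
  rw [h2] at h1
  exact absurd (Complex.ofReal_eq_zero.1 h1.symm) (slY_sq_pos _ hq h r).ne'

lemma IsSol.csol {q : ℝ → ℝ} {μ : ℝ} {y y' : ℝ → ℝ} (h : IsSol q μ y y') :
    CSol (fun t => slC q t - (μ : ℂ)) (fun t => (y t : ℂ)) (fun t => (y' t : ℂ)) := by
  constructor
  · intro x hx
    exact (h.1 x hx).ofReal_comp
  · intro x hx
    beta_reduce
    rw [h.2 x hx, Complex.ofReal_add, ← intervalIntegral.integral_ofReal]
    congr 2; ext t; simp

lemma sl_cot_mul {α : ℝ} (hα : α ∈ Ioo (0:ℝ) π) {a b : ℝ} :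
    a * Real.cos α + b * Real.sin α = 0 ↔ b = -Real.cot α * a := by
  have hs : Real.sin α ≠ 0 := (Real.sin_pos_of_mem_Ioo hα).ne'
  rw [Real.cot_eq_cos_div_sin]
  constructor
  · intro h; field_simp; linarith
  · intro h; rw [h]; field_simp; ring

lemma sl_eig_iff {q : ℝ → ℝ} (hq : IntervalIntegrable (slC q) volume 0 π) {α β : ℝ}
    (hα : α ∈ Ioo (0:ℝ) π) (hβ : β ∈ Ioo (0:ℝ) π) (l : ℝ) :
    IsEigenvalue q α β l ↔ slW (slC q) hq ((-Real.cot α : ℝ) : ℂ) ((Real.cot β : ℝ) : ℂ) l = 0 := by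
  set h : ℝ := -Real.cot α with hh
  set H : ℝ := Real.cot β with hH
  constructor
  · rintro ⟨y, y', hs, ⟨x, hx, hne⟩, b0, b1⟩
    rw [sl_cot_mul hα] at b0
    rw [sl_cot_mul hβ] at b1
    have u := (slY_csol (slC q) hq h l).uniq hs.csol (sl_pq hq _) (y 0)
      (by simp [slY_zero]) (by rw [slY'_zero, b0, ← hh]; push_cast; ring)
    have y0 : (y 0 : ℂ) ≠ 0 := by
      intro h0
      have := (u x hx).1
      rw [h0, zero_mul] at this
      exact hne (by exact_mod_cast this)
    have u1 := u π sl_pi_mem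
    have b1' : (y' π : ℂ) = -(H:ℂ) * (y π : ℂ) := by rw [b1, ← hH]; push_cast; ring
    rw [u1.1, u1.2] at b1'
    have : (y 0 : ℂ) * slW (slC q) hq h H l = 0 := by rw [slW, mul_add, b1']; ring
    exact (mul_eq_zero.1 this).resolve_left y0
  · intro hw
    refine ⟨fun x => (slY (slC q) hq h l x).re, fun x => (slY' (slC q) hq h l x).re, ⟨?_, ?_⟩, ?_, ?_, ?_⟩
    · intro x hx
      exact (Complex.reCLM.hasFDerivAt.comp_hasDerivAt x ((slY_csol (slC q) hq h l).1 x hx))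
    · intro x hx
      have h1 := (slY_csol (slC q) hq h l).2 x hx
      have h2 : ∫ t in (0:ℝ)..x, (slC q t - l) * slY (slC q) hq h l t
          = ((∫ t in (0:ℝ)..x, (q t - l) * (slY (slC q) hq h l t).re : ℝ) : ℂ) := by
        rw [← intervalIntegral.integral_ofReal]
        apply intervalIntegral.integral_congr
        intro t ht
        rw [uIcc_of_le hx.1] at ht
        simp only
        rw [(slY_real_im q hq h l (⟨ht.1, ht.2.trans hx.2⟩ : t ∈ Icc 0 π)).1]
        simp
      rw [h2] at h1
      have := congrArg Complex.re h1
      simpa using this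
    · exact ⟨0, ⟨le_rfl, pi_pos.le⟩, by simp [slY_zero]⟩
    · rw [sl_cot_mul hα, ← hh]; simp [slY_zero, slY'_zero]
    · rw [sl_cot_mul hβ]
      have := congrArg Complex.re hw
      simp [slW] at this
      simp only [← hH]; linarith


lemma sl_cos_le (w : ℂ) : ‖Complex.cos w‖ ≤ Real.exp |w.im| := by
  rw [Complex.cos, norm_div, Complex.norm_ofNat, div_le_iff₀ two_pos]
  refine (norm_add_le _ _).trans ?_
  rw [Complex.norm_exp, Complex.norm_exp]
  have h1 : Real.exp (w * Complex.I).re ≤ Real.exp |w.im| := by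
    apply Real.exp_le_exp.2; simp; exact neg_le_abs _
  have h2 : Real.exp (-w * Complex.I).re ≤ Real.exp |w.im| := by
    apply Real.exp_le_exp.2; simp; exact le_abs_self _
  linarith

lemma sl_sin_le (w : ℂ) : ‖Complex.sin w‖ ≤ Real.exp |w.im| := by
  rw [Complex.sin, norm_div, Complex.norm_ofNat, div_le_iff₀ two_pos, norm_mul, Complex.norm_I, mul_one]
  refine (norm_sub_le _ _).trans ?_
  rw [Complex.norm_exp, Complex.norm_exp]
  have h1 : Real.exp (w * Complex.I).re ≤ Real.exp |w.im| := by
    apply Real.exp_le_exp.2; simp; exact neg_le_abs _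
  have h2 : Real.exp (-w * Complex.I).re ≤ Real.exp |w.im| := by
    apply Real.exp_le_exp.2; simp; exact le_abs_self _
  linarith

lemma sl_arg_deriv (z : ℂ) (x t : ℝ) :
    HasDerivAt (fun t : ℝ => z * ((x : ℂ) - (t : ℂ))) (-z) t := by
  simpa using (((Complex.ofRealCLM.hasDerivAt (x := t)).const_sub (x : ℂ)).const_mul z)

lemma sl_sin_deriv (z : ℂ) (x t : ℝ) :
    HasDerivAt (fun t : ℝ => Complex.sin (z * ((x : ℂ) - (t : ℂ))))
      (-z * Complex.cos (z * ((x : ℂ) - (t : ℂ)))) t := by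
  have := (Complex.hasDerivAt_sin (z * ((x : ℂ) - (t : ℂ)))).comp_of_eq t (sl_arg_deriv z x t) rfl
  exact this.congr_deriv (by ring)

lemma sl_cos_deriv (z : ℂ) (x t : ℝ) :
    HasDerivAt (fun t : ℝ => Complex.cos (z * ((x : ℂ) - (t : ℂ))))
      (z * Complex.sin (z * ((x : ℂ) - (t : ℂ)))) t := by
  have := (Complex.hasDerivAt_cos (z * ((x : ℂ) - (t : ℂ)))).comp_of_eq t (sl_arg_deriv z x t) rfl
  exact this.congr_deriv (by ring)

lemma sl_var_sin (q : ℝ → ℂ) (hq : IntervalIntegrable q volume 0 π) (h z : ℂ) {x : ℝ}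
    (hx : x ∈ Icc 0 π) :
    z * slY q hq h (z ^ 2) x = z * Complex.cos (z * x) + h * Complex.sin (z * x)
      + ∫ t in (0:ℝ)..x, q t * (slY q hq h (z ^ 2) t * Complex.sin (z * ((x : ℂ) - (t : ℂ)))) := by
  have g := (slY_csol q hq h (z ^ 2)).green (p₂ := fun _ => - z ^ 2) (sl_pq hq _) (by simp) hx
    (y₂ := fun t => Complex.sin (z * ((x : ℂ) - (t : ℂ))))
    (y₂' := fun t => -z * Complex.cos (z * ((x : ℂ) - (t : ℂ))))
    (fun t _ => sl_sin_deriv z x t) (fun t _ => by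
      have : ∫ s in (0:ℝ)..t, -z ^ 2 * Complex.sin (z * ((x : ℂ) - (s : ℂ)))
          = -z * Complex.cos (z * ((x : ℂ) - (t : ℂ))) - -z * Complex.cos (z * ((x : ℂ) - ((0:ℝ) : ℂ))) := by
        apply intervalIntegral.integral_eq_sub_of_hasDerivAt (f := fun t : ℝ => -z * Complex.cos (z * ((x : ℂ) - (t : ℂ))))
        · intro s _
          exact ((sl_cos_deriv z x s).const_mul (-z)).congr_deriv (by ring)
        · exact Continuous.intervalIntegrable (by fun_prop) _ _
      rw [this]; ring)
  rw [slY_zero, slY'_zero] at g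
  have e : ∫ t in (0:ℝ)..x, (q t - z ^ 2 - -z ^ 2) * (slY q hq h (z ^ 2) t * Complex.sin (z * ((x : ℂ) - (t : ℂ))))
     = ∫ t in (0:ℝ)..x, q t * (slY q hq h (z ^ 2) t * Complex.sin (z * ((x : ℂ) - (t : ℂ)))) := by
    congr 1; ext t; ring
  rw [e] at g
  simp only [sub_self, mul_zero, Complex.sin_zero, Complex.cos_zero, Complex.ofReal_zero, sub_zero] at g
  rw [← g]; ring

lemma sl_var_cos (q : ℝ → ℂ) (hq : IntervalIntegrable q volume 0 π) (h z : ℂ) {x : ℝ}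
    (hx : x ∈ Icc 0 π) :
    slY' q hq h (z ^ 2) x = h * Complex.cos (z * x) - z * Complex.sin (z * x)
      + ∫ t in (0:ℝ)..x, q t * (slY q hq h (z ^ 2) t * Complex.cos (z * ((x : ℂ) - (t : ℂ)))) := by
  have g := (slY_csol q hq h (z ^ 2)).green (p₂ := fun _ => - z ^ 2) (sl_pq hq _) (by simp) hx
    (y₂ := fun t => Complex.cos (z * ((x : ℂ) - (t : ℂ))))
    (y₂' := fun t => z * Complex.sin (z * ((x : ℂ) - (t : ℂ))))
    (fun t _ => sl_cos_deriv z x t) (fun t _ => by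
      have : ∫ s in (0:ℝ)..t, -z ^ 2 * Complex.cos (z * ((x : ℂ) - (s : ℂ)))
          = z * Complex.sin (z * ((x : ℂ) - (t : ℂ))) - z * Complex.sin (z * ((x : ℂ) - ((0:ℝ) : ℂ))) := by
        apply intervalIntegral.integral_eq_sub_of_hasDerivAt (f := fun t : ℝ => z * Complex.sin (z * ((x : ℂ) - (t : ℂ))))
        · intro s _
          exact ((sl_sin_deriv z x s).const_mul z).congr_deriv (by ring)
        · exact Continuous.intervalIntegrable (by fun_prop) _ _
      rw [this]; ring)
  rw [slY_zero, slY'_zero] at g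
  have e : ∫ t in (0:ℝ)..x, (q t - z ^ 2 - -z ^ 2) * (slY q hq h (z ^ 2) t * Complex.cos (z * ((x : ℂ) - (t : ℂ))))
     = ∫ t in (0:ℝ)..x, q t * (slY q hq h (z ^ 2) t * Complex.cos (z * ((x : ℂ) - (t : ℂ)))) := by
    congr 1; ext t; ring
  rw [e] at g
  simp only [sub_self, mul_zero, Complex.sin_zero, Complex.cos_zero, Complex.ofReal_zero, sub_zero] at g
  rw [← g]; ring

lemma sl_im_bd (z : ℂ) {x t : ℝ} (h : t ≤ x) : |(z * ((x : ℂ) - (t : ℂ))).im| = |z.im| * (x - t) := by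
  have : (z * ((x : ℂ) - (t : ℂ))).im = z.im * (x - t) := by simp
  rw [this, abs_mul, abs_of_nonneg (sub_nonneg.2 h)]

lemma sl_im_bd0 (z : ℂ) {x : ℝ} (h : 0 ≤ x) : |(z * (x : ℂ)).im| = |z.im| * x := by
  simpa using sl_im_bd z h

/-- bound of the perturbation integral -/
lemma sl_pert (q : ℝ → ℂ) (hq : IntervalIntegrable q volume 0 π) (y k : ℝ → ℂ) (τ m : ℝ)
    (hm : 0 ≤ m) {x : ℝ} (hx : x ∈ Icc 0 π) (hy : ∀ t ∈ Icc 0 π, ‖y t‖ ≤ m * Real.exp (τ * t))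
    (hk : ∀ t ∈ Icc 0 x, ‖k t‖ ≤ Real.exp (τ * (x - t))) :
    ‖∫ t in (0:ℝ)..x, q t * (y t * k t)‖ ≤ (∫ t in (0:ℝ)..π, ‖q t‖) * (m * Real.exp (τ * x)) := by
  refine (sl_int_norm_le hx.1 ((sl_ii_mono hq hx).norm.mul_const (m * Real.exp (τ * x)))
    (fun t ht => ?_)).trans ?_
  · rw [norm_mul, norm_mul]
    apply mul_le_mul_of_nonneg_left _ (norm_nonneg _)
    have e : m * Real.exp (τ * x) = m * Real.exp (τ * t) * Real.exp (τ * (x - t)) := by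
      rw [mul_assoc, ← Real.exp_add]; ring_nf
    rw [e]
    exact mul_le_mul (hy t ⟨ht.1, ht.2.trans hx.2⟩) (hk t ht) (norm_nonneg _) (by positivity)
  · rw [intervalIntegral.integral_mul_const]
    exact mul_le_mul_of_nonneg_right (sl_int_mono hq hx) (by positivity)

lemma slY_bound (q : ℝ → ℂ) (hq : IntervalIntegrable q volume 0 π) (h z : ℂ)
    (h1 : 1 ≤ ‖z‖) (h2 : 2 * (∫ t in (0:ℝ)..π, ‖q t‖) ≤ ‖z‖) :
    ∀ x ∈ Icc 0 π, ‖slY q hq h (z ^ 2) x‖ ≤ 2 * (1 + ‖h‖) * Real.exp (|z.im| * x) := by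
  set τ := |z.im|
  set Q := ∫ t in (0:ℝ)..π, ‖q t‖
  have hc : ContinuousOn (fun x : ℝ => Real.exp (-τ * x) * ‖slY q hq h (z ^ 2) x‖) (Icc 0 π) :=
    ContinuousOn.mul (by fun_prop) (slY_cont q hq h _).norm
  obtain ⟨x0, hx0, hmax⟩ := isCompact_Icc.exists_isMaxOn ⟨0, le_rfl, pi_pos.le⟩ hc
  set m := Real.exp (-τ * x0) * ‖slY q hq h (z ^ 2) x0‖ with hm
  have hm0 : 0 ≤ m := by positivity
  have hee : ∀ x, Real.exp (-τ * x) * Real.exp (τ * x) = 1 := fun x => by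
    rw [← Real.exp_add]; simp
  have hy : ∀ x ∈ Icc 0 π, ‖slY q hq h (z ^ 2) x‖ ≤ m * Real.exp (τ * x) := by
    intro x hx
    have : Real.exp (-τ * x) * ‖slY q hq h (z ^ 2) x‖ ≤ m := hmax hx
    calc ‖slY q hq h (z ^ 2) x‖ = (Real.exp (-τ * x) * ‖slY q hq h (z ^ 2) x‖) * Real.exp (τ * x) := by
          rw [mul_right_comm, hee, one_mul]
      _ ≤ _ := mul_le_mul_of_nonneg_right this (Real.exp_pos _).le
  have hv := sl_var_sin q hq h z hx0
  have hp := sl_pert q hq (slY q hq h (z ^ 2)) (fun t => Complex.sin (z * ((x0 : ℂ) - (t : ℂ)))) τ m hm0 hx0 hy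
    (fun t ht => (sl_sin_le _).trans (by rw [sl_im_bd z ht.2]))
  have b1 : ‖Complex.cos (z * x0)‖ ≤ Real.exp (τ * x0) := (sl_cos_le _).trans (by rw [sl_im_bd0 z hx0.1])
  have b2 : ‖Complex.sin (z * x0)‖ ≤ Real.exp (τ * x0) := (sl_sin_le _).trans (by rw [sl_im_bd0 z hx0.1])
  have hn : ‖z‖ * ‖slY q hq h (z ^ 2) x0‖ ≤ (‖z‖ + ‖h‖ + Q * m) * Real.exp (τ * x0) := by
    rw [← norm_mul, hv]
    refine (norm_add₃_le).trans ?_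
    rw [norm_mul, norm_mul]
    have := mul_le_mul_of_nonneg_left b1 (norm_nonneg z)
    have := mul_le_mul_of_nonneg_left b2 (norm_nonneg h)
    linarith
  have hn2 : ‖z‖ * m ≤ ‖z‖ + ‖h‖ + Q * m := by
    have := mul_le_mul_of_nonneg_left hn (Real.exp_pos (-τ * x0)).le
    calc ‖z‖ * m = Real.exp (-τ * x0) * (‖z‖ * ‖slY q hq h (z ^ 2) x0‖) := by rw [hm]; ring
      _ ≤ _ := this
      _ = (‖z‖ + ‖h‖ + Q * m) * (Real.exp (-τ * x0) * Real.exp (τ * x0)) := by ring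
      _ = _ := by rw [hee, mul_one]
  have hm2 : m ≤ 2 * (1 + ‖h‖) := by
    have : ‖h‖ ≤ ‖z‖ * ‖h‖ := le_mul_of_one_le_left (norm_nonneg _) h1
    have h3 : ‖z‖ * m ≤ ‖z‖ * (2 * (1 + ‖h‖)) := by nlinarith
    exact le_of_mul_le_mul_left h3 (by linarith)
  intro x hx
  exact (hy x hx).trans (mul_le_mul_of_nonneg_right hm2 (Real.exp_pos _).le)

lemma slW_asymp (q : ℝ → ℂ) (hq : IntervalIntegrable q volume 0 π) (h H : ℂ) :
    ∃ C Z : ℝ, 0 ≤ C ∧ 1 ≤ Z ∧ ∀ z : ℂ, Z ≤ ‖z‖ →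
      ‖slW q hq h H (z ^ 2) + z * Complex.sin (π * z)‖ ≤ C * Real.exp (π * |z.im|) := by
  set Q := ∫ t in (0:ℝ)..π, ‖q t‖ with hQ
  have hQ0 : 0 ≤ Q := intervalIntegral.integral_nonneg pi_pos.le (fun _ _ => norm_nonneg _)
  refine ⟨‖h‖ + (Q + ‖H‖) * (2 * (1 + ‖h‖)), max 1 (2 * Q), by positivity, le_max_left _ _, ?_⟩
  intro z hz
  have hy := slY_bound q hq h z ((le_max_left _ _).trans hz) ((le_max_right _ _).trans hz)
  have hp := sl_pert q hq (slY q hq h (z ^ 2)) (fun t => Complex.cos (z * ((π : ℂ) - (t : ℂ)))) |z.im|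
    (2 * (1 + ‖h‖)) (by positivity) sl_pi_mem hy
    (fun t ht => (sl_cos_le _).trans (by rw [sl_im_bd z ht.2]))
  have b1 : ‖Complex.cos (z * π)‖ ≤ Real.exp (|z.im| * π) :=
    (sl_cos_le _).trans (by rw [sl_im_bd0 z pi_pos.le])
  have hyπ := hy π sl_pi_mem
  have e : slW q hq h H (z ^ 2) + z * Complex.sin (π * z) = h * Complex.cos (z * π)
      + (∫ t in (0:ℝ)..π, q t * (slY q hq h (z ^ 2) t * Complex.cos (z * ((π : ℂ) - (t : ℂ)))))
      + H * slY q hq h (z ^ 2) π := by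
    rw [slW, sl_var_cos q hq h z sl_pi_mem, mul_comm (π : ℂ) z]; ring
  rw [e, mul_comm π]
  refine (norm_add₃_le).trans ?_
  rw [norm_mul, norm_mul]
  have := mul_le_mul_of_nonneg_left b1 (norm_nonneg h)
  have := mul_le_mul_of_nonneg_left hyπ (norm_nonneg H)
  linarith

def slZ : ℂ → ℂ := slW (slC (fun _ => 0)) (by simp [slC]) ((0:ℝ):ℂ) ((0:ℝ):ℂ)

lemma slZ_sq (z : ℂ) : slZ (z ^ 2) = - (z * Complex.sin (π * z)) := by
  rw [slZ, slW, sl_var_cos _ _ _ _ sl_pi_mem]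
  simp [slC, mul_comm]


lemma sl_factor {F : ℂ → ℂ} (hF : Differentiable ℂ F) {a : ℕ → ℂ} (ha : Function.Injective a)
    (hz : ∀ k, F (a k) = 0) (S : Finset ℕ) :
    ∃ g : ℂ → ℂ, Differentiable ℂ g ∧ ∀ l, F l = (∏ k ∈ S, (a k - l)) * g l := by
  induction S using Finset.induction_on with
  | empty => exact ⟨F, hF, fun l => by simp⟩
  | insert n S hn ih =>
    obtain ⟨g, hg, he⟩ := ih
    have h0 : g (a n) = 0 := by
      have := he (a n)
      rw [hz n] at this
      rcases mul_eq_zero.1 this.symm with h | h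
      · obtain ⟨k, hk, hk'⟩ := Finset.prod_eq_zero_iff.1 h
        exact absurd (ha (sub_eq_zero.1 hk')) (fun e => hn (e ▸ hk))
      · exact h
    refine ⟨fun l => - dslope g (a n) l, ?_, ?_⟩
    · apply Differentiable.fun_neg
      rw [← differentiableOn_univ] at hg ⊢
      exact (Complex.differentiableOn_dslope (by simp)).2 hg
    · intro l
      have : (l - a n) • dslope g (a n) l = g l - g (a n) := sub_smul_dslope g (a n) l
      rw [h0, sub_zero, smul_eq_mul] at this
      rw [he l, Finset.prod_insert hn, ← this]; ring

lemma sl_factor_deriv {F g : ℂ → ℂ} (hg : Differentiable ℂ g) {a : ℕ → ℂ} {S : Finset ℕ}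
    (he : ∀ l, F l = (∏ k ∈ S, (a k - l)) * g l) {n : ℕ} (hn : n ∈ S) :
    deriv F (a n) = - ((∏ k ∈ S.erase n, (a k - a n)) * g (a n)) := by
  have h1 : F = fun l => (a n - l) * ((∏ k ∈ S.erase n, (a k - l)) * g l) := by
    ext l
    rw [he l, ← Finset.mul_prod_erase S _ hn]; ring
  have h2 : DifferentiableAt ℂ (fun l => (∏ k ∈ S.erase n, (a k - l)) * g l) (a n) := by
    fun_prop
  have h3 : HasDerivAt (fun l => a n - l) (-1) (a n) := (hasDerivAt_id (a n)).const_sub (a n)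
  have h4 := (h3.mul h2.hasDerivAt).deriv
  rw [h1]
  refine Eq.trans h4 ?_
  simp

lemma sl_prod_ne {a : ℕ → ℂ} {S : Finset ℕ} {r : ℝ} (hS : ∀ k ∈ S, a k ∈ Metric.ball (0:ℂ) r)
    {l : ℂ} (hl : l ∈ Metric.sphere (0:ℂ) r) : ∀ k ∈ S, a k - l ≠ 0 := by
  intro k hk h
  have h1 := hS k hk
  rw [sub_eq_zero.1 h] at h1
  simp at h1 hl
  linarith

lemma sl_logint {g : ℂ → ℂ} (hg : Differentiable ℂ g) {a : ℕ → ℂ} {S : Finset ℕ} {r : ℝ} (hr : 0 < r)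
    (hS : ∀ k ∈ S, a k ∈ Metric.ball (0:ℂ) r) (hg0 : ∀ l ∈ Metric.closedBall (0:ℂ) r, g l ≠ 0) :
    CircleIntegrable (logDeriv (fun l => (∏ k ∈ S, (a k - l)) * g l)) 0 r ∧
    ∮ l in C(0, r), logDeriv (fun l => (∏ k ∈ S, (a k - l)) * g l) l = 2 * π * Complex.I * S.card := by
  have hd : Differentiable ℂ (deriv g) := hg.deriv
  have e : EqOn (logDeriv (fun l => (∏ k ∈ S, (a k - l)) * g l))
      (fun l => (∑ k ∈ S, (l - a k)⁻¹) + deriv g l / g l) (Metric.sphere 0 r) := by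
    intro l hl
    have hne := sl_prod_ne hS hl
    rw [logDeriv_mul l (Finset.prod_ne_zero_iff.2 hne) (hg0 l (Metric.sphere_subset_closedBall hl))
      (by fun_prop) (hg l), logDeriv_prod hne (fun k _ => by fun_prop)]
    congr 1
    refine Finset.sum_congr rfl (fun k hk => ?_)
    have h3 : HasDerivAt (fun l => a k - l) (-1) l := (hasDerivAt_id l).const_sub (a k)
    rw [logDeriv_apply, h3.deriv, neg_div, one_div, ← inv_neg, neg_sub]
  have c1 : ∀ k ∈ S, CircleIntegrable (fun l => (l - a k)⁻¹) 0 r := by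
    intro k hk
    apply ContinuousOn.circleIntegrable hr.le
    apply ContinuousOn.inv₀ (by fun_prop)
    intro l hl h
    exact sl_prod_ne hS hl k hk (by rw [← neg_sub, h, neg_zero])
  have cg : ContinuousOn (fun l => deriv g l / g l) (Metric.closedBall 0 r) :=
    hd.continuous.continuousOn.div hg.continuous.continuousOn hg0
  have c2 : CircleIntegrable (fun l => deriv g l / g l) 0 r :=
    (cg.mono Metric.sphere_subset_closedBall).circleIntegrable hr.le
  have c3 : CircleIntegrable (fun l => ∑ k ∈ S, (l - a k)⁻¹) 0 r := CircleIntegrable.fun_sum S c1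
  constructor
  · refine ContinuousOn.circleIntegrable hr.le (ContinuousOn.congr ?_ e)
    refine ContinuousOn.add (continuousOn_finset_sum _ (fun k hk => ?_))
      (cg.mono Metric.sphere_subset_closedBall)
    apply ContinuousOn.inv₀ (by fun_prop)
    intro l hl h
    exact sl_prod_ne hS hl k hk (by rw [← neg_sub, h, neg_zero])
  · rw [circleIntegral.integral_congr hr.le e, circleIntegral.integral_add c3 c2,
      circleIntegral.integral_fun_sum c1,
      Finset.sum_congr rfl (fun k hk => circleIntegral.integral_sub_inv_of_mem_ball (hS k hk)),
      Complex.circleIntegral_eq_zero_of_differentiable_on_off_countable hr.le countable_empty cg]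
    · simp; ring
    · intro z hz
      exact (hd z).div (hg z) (hg0 z (Metric.ball_subset_closedBall hz.1))

lemma sl_rouche {f f0 g g0 : ℂ → ℂ} (hg : Differentiable ℂ g) (hg0 : Differentiable ℂ g0)
    {a a0 : ℕ → ℂ} {S S0 : Finset ℕ} {r : ℝ} (hr : 0 < r)
    (hS : ∀ k ∈ S, a k ∈ Metric.ball (0:ℂ) r) (hS0 : ∀ k ∈ S0, a0 k ∈ Metric.ball (0:ℂ) r)
    (gn : ∀ l ∈ Metric.closedBall (0:ℂ) r, g l ≠ 0) (g0n : ∀ l ∈ Metric.closedBall (0:ℂ) r, g0 l ≠ 0)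
    (hf : ∀ l, f l = (∏ k ∈ S, (a k - l)) * g l) (hf0 : ∀ l, f0 l = (∏ k ∈ S0, (a0 k - l)) * g0 l)
    (hc : ∀ l ∈ Metric.sphere (0:ℂ) r, ‖f l / f0 l - 1‖ < 1) : S.card = S0.card := by
  obtain ⟨i1, h1⟩ := sl_logint hg hr hS gn
  obtain ⟨i2, h2⟩ := sl_logint hg0 hr hS0 g0n
  rw [← funext hf] at h1 i1
  rw [← funext hf0] at h2 i2
  have df : Differentiable ℂ f := by rw [funext hf]; fun_prop
  have df0 : Differentiable ℂ f0 := by rw [funext hf0]; fun_prop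
  have key : ∮ l in C(0, r), (logDeriv f l - logDeriv f0 l) = 0 := by
    apply circleIntegral.integral_eq_zero_of_hasDerivWithinAt (f := fun l => Complex.log (f l / f0 l)) hr.le
    intro l hl
    have n1 : f l ≠ 0 := by
      rw [hf]; exact mul_ne_zero (Finset.prod_ne_zero_iff.2 (sl_prod_ne hS hl)) (gn l (Metric.sphere_subset_closedBall hl))
    have n2 : f0 l ≠ 0 := by
      rw [hf0]; exact mul_ne_zero (Finset.prod_ne_zero_iff.2 (sl_prod_ne hS0 hl)) (g0n l (Metric.sphere_subset_closedBall hl))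
    have hs : f l / f0 l ∈ Complex.slitPlane := by
      apply Complex.ball_one_subset_slitPlane
      simpa [dist_eq_norm] using hc l hl
    have := ((df l).hasDerivAt.fun_div (df0 l).hasDerivAt n2).clog hs
    refine (this.congr_deriv ?_).hasDerivWithinAt
    rw [logDeriv_apply, logDeriv_apply]
    field_simp
  rw [circleIntegral.integral_sub i1 i2, h1, h2] at key
  have h3 : (2 * π * Complex.I) * ((S.card : ℂ) - S0.card) = 0 := by rw [← key]; ring
  have h4 := (mul_eq_zero.1 h3).resolve_left Complex.two_pi_I_ne_zero
  exact_mod_cast sub_eq_zero.1 h4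


lemma sl_sin_nsq (w : ℂ) : ‖Complex.sin w‖ ^ 2 = Real.sin w.re ^ 2 + Real.sinh w.im ^ 2 := by
  rw [Complex.sq_norm, Complex.sin_eq, Complex.normSq_apply]
  simp only [← Complex.ofReal_sin, ← Complex.ofReal_cos, ← Complex.ofReal_sinh, ← Complex.ofReal_cosh,
    Complex.add_re, Complex.add_im, Complex.re_ofReal_mul, Complex.im_ofReal_mul, Complex.mul_re, Complex.mul_im,
    Complex.ofReal_re, Complex.ofReal_im, Complex.I_re, Complex.I_im, mul_zero, mul_one, zero_mul, add_zero, zero_add, sub_zero]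
  have h1 := Real.cosh_sq w.im
  have h2 := Real.sin_sq_add_cos_sq w.re
  have e : Real.cos w.re ^ 2 = 1 - Real.sin w.re ^ 2 := by linarith
  have : Real.sin w.re * Real.cosh w.im * (Real.sin w.re * Real.cosh w.im) +
    Real.cos w.re * Real.sinh w.im * (Real.cos w.re * Real.sinh w.im)
     = Real.sin w.re ^ 2 * Real.cosh w.im ^ 2 + Real.cos w.re ^ 2 * Real.sinh w.im ^ 2 := by ring
  rw [this, h1, e]; ring

lemma sl_sin_lower (N : ℕ) (z : ℂ) (hz : ‖z‖ = N + 1 / 2) :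
    Real.exp (π * |z.im|) ≤ 4 * ‖Complex.sin (π * z)‖ := by
  have h := sl_sin_nsq (π * z)
  simp only [Complex.re_ofReal_mul, Complex.im_ofReal_mul] at h
  have hpi := Real.pi_gt_three
  have hpi2 := Real.pi_lt_d2
  have hn := norm_nonneg (Complex.sin (π * z))
  apply le_of_sq_le_sq _ (by positivity)
  rw [mul_pow, h]
  rcases le_or_gt (1/4) |z.im| with hy | hy
  · have e1 : Real.sinh (π * z.im) ^ 2 = Real.sinh (π * |z.im|) ^ 2 := by
      rcases abs_cases z.im with h | h
      · rw [h.1]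
      · rw [h.1, mul_neg, Real.sinh_neg, neg_sq]
    rw [e1]
    set t := π * |z.im| with ht
    have ht1 : 3/4 ≤ t := by nlinarith
    have e2 : 2 ≤ Real.exp t * Real.exp t := by
      rw [← Real.exp_add]; linarith [Real.add_one_le_exp (t + t)]
    have e3 : Real.exp t * Real.exp (-t) = 1 := by rw [← Real.exp_add]; simp
    have e4 := Real.exp_pos t
    have e5 := Real.exp_pos (-t)
    have e6 : Real.exp t ≤ 4 * Real.sinh t := by
      rw [Real.sinh_eq]
      have : Real.exp (-t) * 2 ≤ Real.exp t := by nlinarith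
      linarith
    nlinarith [sq_nonneg (Real.sin (π * z.re))]
  · have hsq : z.re ^ 2 + z.im ^ 2 = (N + 1/2) ^ 2 := by
      rw [← hz, Complex.sq_norm, Complex.normSq_apply]; ring
    have hN : (0:ℝ) ≤ N := Nat.cast_nonneg N
    have hy2 : z.im ^ 2 ≤ 1/16 := by rw [← sq_abs]; nlinarith [abs_nonneg z.im]
    set d := (N:ℝ) + 1/2 - |z.re| with hd
    have hx2 : |z.re| ^ 2 = z.re ^ 2 := sq_abs _
    have hx0 := abs_nonneg z.re
    have hd0 : 0 ≤ d := by nlinarith [sq_nonneg z.im]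
    have hd1 : d ≤ 1/8 := by
      by_contra hcon
      push Not at hcon
      have : |z.re| < N + 1/2 - 1/8 := by linarith
      nlinarith
    have hs : 1/2 ≤ Real.sin (π * z.re) ^ 2 := by
      rw [Real.sin_sq_eq_half_sub]
      have e1 : Real.cos (2 * (π * z.re)) = Real.cos (2 * (π * |z.re|)) := by
        rcases abs_cases z.re with h | h
        · rw [h.1]
        · rw [h.1, mul_neg, mul_neg, Real.cos_neg]
      have e2 : 2 * (π * |z.re|) = (π - 2 * π * d) + N * (2 * π) := by rw [hd]; ring
      rw [e1, e2, Real.cos_add_nat_mul_two_pi, Real.cos_pi_sub]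
      have : 0 ≤ Real.cos (2 * π * d) := by
        apply Real.cos_nonneg_of_mem_Icc
        constructor <;> nlinarith
      linarith
    have he : Real.exp (π * |z.im|) ≤ 2.7182818286 := by
      refine le_trans (Real.exp_le_exp.2 ?_) Real.exp_one_lt_d9.le
      nlinarith [abs_nonneg z.im]
    have := Real.exp_pos (π * |z.im|)
    nlinarith [sq_nonneg (Real.sinh (π * z.im))]

def SlAs (F : ℂ → ℂ) : Prop := ∃ C Z : ℝ, 0 ≤ C ∧ 1 ≤ Z ∧ ∀ z : ℂ, Z ≤ ‖z‖ →
      ‖F (z ^ 2) + z * Complex.sin (π * z)‖ ≤ C * Real.exp (π * |z.im|)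

def slr (N : ℕ) : ℝ := ((N:ℝ) + 1/2) ^ 2

lemma slr_pos (N : ℕ) : 0 < slr N := by unfold slr; positivity

lemma slZ_circle (N : ℕ) (l : ℂ) (hl : ‖l‖ = slr N) : slZ l ≠ 0 := by
  obtain ⟨z, rfl⟩ := IsAlgClosed.exists_pow_nat_eq l two_pos
  have hz : ‖z‖ = N + 1/2 := by
    rw [norm_pow, slr] at hl
    exact (pow_left_inj₀ (norm_nonneg z) (by positivity) two_ne_zero).1 hl
  have := sl_sin_lower N z hz
  have h2 := Real.exp_pos (π * |z.im|)
  rw [slZ_sq, neg_ne_zero]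
  apply mul_ne_zero
  · rw [← norm_ne_zero_iff, hz]; positivity
  · rw [← norm_pos_iff]; linarith

lemma sl_circle {F : ℂ → ℂ} (hF : SlAs F) : ∃ C : ℝ, 0 ≤ C ∧ ∃ N0 : ℕ, ∀ N ≥ N0, ∀ l : ℂ,
    ‖l‖ = slr N → ‖F l / slZ l - 1‖ ≤ C / (N + 1/2) := by
  obtain ⟨C, Z, hC, hZ, h⟩ := hF
  refine ⟨4 * C, by positivity, ⌈Z⌉₊, fun N hN l hl => ?_⟩
  have hne := slZ_circle N l hl
  obtain ⟨z, rfl⟩ := IsAlgClosed.exists_pow_nat_eq l two_pos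
  have hz : ‖z‖ = N + 1/2 := by
    rw [norm_pow, slr] at hl
    exact (pow_left_inj₀ (norm_nonneg z) (by positivity) two_ne_zero).1 hl
  have hs := sl_sin_lower N z hz
  have hZ' : Z ≤ ‖z‖ := by
    rw [hz]; have := Nat.ceil_le.1 hN; linarith
  have hh := h z hZ'
  rw [div_sub_one hne, norm_div, slZ_sq, sub_neg_eq_add, norm_neg, norm_mul, hz]
  have hpos : 0 < ‖Complex.sin (π * z)‖ := by have := Real.exp_pos (π * |z.im|); linarith
  rw [div_le_div_iff₀ (by positivity) (by positivity)]
  have : C * Real.exp (π * |z.im|) ≤ C * (4 * ‖Complex.sin (π * z)‖) := mul_le_mul_of_nonneg_left hs hC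
  have h3 : ‖F (z ^ 2) + z * Complex.sin (π * z)‖ ≤ C * (4 * ‖Complex.sin (π * z)‖) := hh.trans this
  have := mul_le_mul_of_nonneg_right h3 (show (0:ℝ) ≤ N + 1/2 by positivity)
  linarith

lemma slZ_diff : Differentiable ℂ slZ := slW_diff _ _ _ _

lemma slZ_zero (l : ℂ) : slZ l = 0 ↔ ∃ k : ℕ, l = ((k:ℂ)) ^ 2 := by
  constructor
  · intro h
    obtain ⟨z, rfl⟩ := IsAlgClosed.exists_pow_nat_eq l two_pos
    rw [slZ_sq, neg_eq_zero, mul_eq_zero] at h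
    rcases h with h | h
    · exact ⟨0, by simp [h]⟩
    · obtain ⟨k, hk⟩ := Complex.sin_eq_zero_iff.1 h
      have : z = k := by
        have hp : (π : ℂ) ≠ 0 := by exact_mod_cast Real.pi_ne_zero
        apply mul_left_cancel₀ hp; rw [hk]; ring
      refine ⟨k.natAbs, ?_⟩
      rw [this]
      have := Int.natAbs_sq k
      have h2 : ((k.natAbs : ℤ) : ℂ) ^ 2 = (k : ℂ) ^ 2 := by rw [← Int.cast_pow, this, Int.cast_pow]
      rw [← h2]; simp
  · rintro ⟨k, rfl⟩
    rw [slZ_sq, mul_comm (π:ℂ), Complex.sin_nat_mul_pi]; simp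

lemma slZ_simple (l : ℂ) (h : slZ l = 0) : deriv slZ l ≠ 0 :=
  slW_deriv_ne (fun _ => 0) _ 0 0 l h

lemma sl_sq_inj : Function.Injective (fun k : ℕ => (k:ℂ) ^ 2) := by
  intro a b h
  simp only at h
  have : a ^ 2 = b ^ 2 := by exact_mod_cast h
  exact Nat.pow_left_injective two_ne_zero this

lemma sl_sq_lt (N k : ℕ) : (k:ℝ) ^ 2 < slr N ↔ k ≤ N := by
  rw [slr, pow_lt_pow_iff_left₀ (by positivity) (by positivity) two_ne_zero]
  constructor
  · intro h
    by_contra hc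
    push Not at hc
    have : (N:ℝ) + 1 ≤ k := by exact_mod_cast hc
    linarith
  · intro h
    have : (k:ℝ) ≤ N := by exact_mod_cast h
    linarith

lemma sl_fin_zeros {F : ℂ → ℂ} (hF : Differentiable ℂ F) {c : ℂ} (hc : F c ≠ 0) {a : ℕ → ℂ}
    (ha : Function.Injective a) (hz : ∀ k, F (a k) = 0) (r : ℝ) : {k : ℕ | ‖a k‖ < r}.Finite := by
  by_contra hinf
  have h1 : (a '' {k : ℕ | ‖a k‖ < r}).Infinite := Set.Infinite.image ha.injOn hinf
  obtain ⟨x, -, hx⟩ := h1.exists_accPt_of_subset_isCompact (isCompact_closedBall (0:ℂ) r) (by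
    rintro _ ⟨k, hk, rfl⟩
    simpa using le_of_lt hk)
  rw [accPt_iff_frequently_nhdsNE] at hx
  have h2 : F = fun _ => 0 := by
    apply AnalyticOnNhd.eq_of_frequently_eq (z₀ := x)
    · exact fun z _ => hF.analyticAt z
    · exact fun z _ => analyticAt_const
    · refine hx.mono ?_
      rintro _ ⟨k, -, rfl⟩
      exact hz k
  exact hc (by rw [h2])

/-- factor with nonvanishing cofactor on the disc -/
lemma sl_factor_ball {F : ℂ → ℂ} (hF : Differentiable ℂ F) {a : ℕ → ℂ} (ha : Function.Injective a)
    (hz : ∀ l, F l = 0 ↔ ∃ k, l = a k) (hs : ∀ l, F l = 0 → deriv F l ≠ 0) {r : ℝ}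
    (hr : ∀ l, ‖l‖ = r → F l ≠ 0) (S : Finset ℕ) (hS : ∀ k, ‖a k‖ < r ↔ k ∈ S) :
    ∃ g : ℂ → ℂ, Differentiable ℂ g ∧ (∀ l, F l = (∏ k ∈ S, (a k - l)) * g l) ∧
      ∀ l ∈ Metric.closedBall (0:ℂ) r, g l ≠ 0 := by
  obtain ⟨g, hg, he⟩ := sl_factor hF ha (fun k => (hz _).2 ⟨k, rfl⟩) S
  refine ⟨g, hg, he, fun l hl h0 => ?_⟩
  have hFl : F l = 0 := by rw [he, h0, mul_zero]
  obtain ⟨k, rfl⟩ := (hz l).1 hFl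
  have hlt : ‖a k‖ < r := lt_of_le_of_ne (by simpa using hl) (fun h => hr _ h hFl)
  apply hs _ hFl
  rw [sl_factor_deriv hg he ((hS k).1 hlt), h0]; simp

lemma slZ_factor (N : ℕ) : ∃ g : ℂ → ℂ, Differentiable ℂ g ∧
    (∀ l, slZ l = (∏ k ∈ Finset.range (N+1), ((k:ℂ) ^ 2 - l)) * g l) ∧
      ∀ l ∈ Metric.closedBall (0:ℂ) (slr N), g l ≠ 0 := by
  apply sl_factor_ball slZ_diff sl_sq_inj slZ_zero slZ_simple (slZ_circle N)
  intro k
  rw [Finset.mem_range, Nat.lt_succ_iff, ← sl_sq_lt]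
  simp

lemma sl_count {F : ℂ → ℂ} (hF : Differentiable ℂ F) (hA : SlAs F) {μ : ℕ → ℝ} (hm : StrictMono μ)
    (hz : ∀ l, F l = 0 ↔ ∃ k, l = (μ k : ℂ)) (hs : ∀ l, F l = 0 → deriv F l ≠ 0) :
    ∃ N0 : ℕ, ∀ N ≥ N0, ∀ k, |μ k| < slr N ↔ k ≤ N := by
  obtain ⟨C, hC, N0, hN0⟩ := sl_circle hA
  have ha : Function.Injective (fun k => (μ k : ℂ)) := fun i j h => hm.injective (Complex.ofReal_injective h)
  refine ⟨max N0 (max ⌈C⌉₊ ⌈|μ 0|⌉₊ + 1), fun N hN => ?_⟩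
  have hN1 : N0 ≤ N := (le_max_left _ _).trans hN
  have hN2 : max ⌈C⌉₊ ⌈|μ 0|⌉₊ + 1 ≤ N := (le_max_right _ _).trans hN
  have hN3 : C ≤ N := Nat.ceil_le.1 (by omega)
  have hN4 : |μ 0| ≤ N := Nat.ceil_le.1 (by omega)
  have hn1 : (1:ℝ) ≤ N := by exact_mod_cast (by omega : 1 ≤ N)
  have hcl : ∀ l : ℂ, ‖l‖ = slr N → ‖F l / slZ l - 1‖ < 1 := by
    intro l hl
    refine (hN0 N hN1 l hl).trans_lt ?_
    rw [div_lt_one (by positivity)]; linarith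
  have hr : ∀ l : ℂ, ‖l‖ = slr N → F l ≠ 0 := by
    intro l hl h0
    have := hcl l hl
    rw [h0] at this; simp at this
  have hl0 : ‖((slr N : ℝ) : ℂ)‖ = slr N := by
    rw [Complex.norm_real, Real.norm_of_nonneg (slr_pos N).le]
  have hfin : {k : ℕ | ‖(μ k : ℂ)‖ < slr N}.Finite :=
    sl_fin_zeros hF (hr _ hl0) ha (fun k => (hz _).2 ⟨k, rfl⟩) _
  set S := hfin.toFinset with hS
  have hmem : ∀ k, ‖(μ k : ℂ)‖ < slr N ↔ k ∈ S := fun k => by rw [hS]; simp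
  obtain ⟨g, hg, he, hgn⟩ := sl_factor_ball hF ha hz hs hr S hmem
  obtain ⟨g0, hg0, he0, hgn0⟩ := slZ_factor N
  have hcard := sl_rouche hg hg0 (slr_pos N) (fun k hk => by simpa using (hmem k).2 hk)
    (S0 := Finset.range (N+1)) (a0 := fun k => (k:ℂ)^2)
    (fun k hk => by
      rw [Finset.mem_range, Nat.lt_succ_iff, ← sl_sq_lt] at hk
      simpa using hk) hgn hgn0 he he0 (fun l hl => hcl l (by simpa using hl))
  rw [Finset.card_range] at hcard
  have hsub : S ⊆ Finset.range (N+1) := by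
    intro j hj
    have : Finset.range (j+1) ⊆ S := by
      intro i hi
      rw [Finset.mem_range, Nat.lt_succ_iff] at hi
      rw [← hmem] at hj ⊢
      rw [Complex.norm_real, Real.norm_eq_abs, abs_lt] at *
      refine ⟨?_, (hm.monotone hi).trans_lt hj.2⟩
      have h1 := hm.monotone (Nat.zero_le i)
      have h2 := neg_abs_le (μ 0)
      have h3 : (N:ℝ) < slr N := by rw [slr]; nlinarith
      linarith
    have := Finset.card_le_card this
    rw [Finset.card_range, hcard] at this
    rw [Finset.mem_range]; omega
  have heq : S = Finset.range (N+1) := Finset.eq_of_subset_of_card_le hsub (by simp [hcard])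
  intro k
  have := hmem k
  rw [heq, Finset.mem_range, Nat.lt_succ_iff, Complex.norm_real, Real.norm_eq_abs] at this
  exact this


lemma sl_sin_jordan {t : ℝ} (ht : |t| ≤ 1/2) : 2 * |t| ≤ |Real.sin (π * t)| := by
  have h1 : |Real.sin (π * t)| = |Real.sin (π * |t|)| := by
    rcases abs_cases t with h | h
    · rw [h.1]
    · rw [h.1, mul_neg, Real.sin_neg, abs_neg]
  have hp := Real.pi_pos
  have h2 := Real.mul_le_sin (x := π * |t|) (by positivity) (by nlinarith)
  rw [h1]
  refine le_trans ?_ (le_abs_self _)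
  refine le_trans (le_of_eq ?_) h2
  field_simp

lemma sl_loc {F : ℂ → ℂ} (hF : Differentiable ℂ F) (hA : SlAs F) {μ : ℕ → ℝ} (hm : StrictMono μ)
    (hz : ∀ l, F l = 0 ↔ ∃ k, l = (μ k : ℂ)) (hs : ∀ l, F l = 0 → deriv F l ≠ 0) :
    ∃ D : ℝ, 0 ≤ D ∧ ∀ k : ℕ, |μ k - (k:ℝ) ^ 2| ≤ D := by
  obtain ⟨N0, hN0⟩ := sl_count hF hA hm hz hs
  obtain ⟨C, Z, hC, hZ, hAs⟩ := hA
  have key : ∀ M ≥ max N0 ⌈Z⌉₊, |μ (M+1) - ((M+1 : ℕ):ℝ) ^ 2| ≤ 2 * C := by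
    intro M hM
    have hM1 : N0 ≤ M := (le_max_left _ _).trans hM
    have hM2 : Z ≤ M := Nat.ceil_le.1 ((le_max_right _ _).trans hM)
    have a1 : |μ (M+1)| < slr (M+1) := (hN0 (M+1) (by omega) (M+1)).2 le_rfl
    have a2 : slr M ≤ |μ (M+1)| := by
      by_contra hc
      have := (hN0 M hM1 (M+1)).1 (not_le.1 hc)
      omega
    have a3 : |μ 0| < slr M := (hN0 M hM1 0).2 (Nat.zero_le _)
    have a4 := hm.monotone (Nat.zero_le (M+1))
    have a5 := neg_abs_le (μ 0)
    have a6 : slr M ≤ μ (M+1) := by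
      rcases abs_cases (μ (M+1)) with h | h
      · linarith [h.1]
      · linarith [h.1]
    have a7 : μ (M+1) < slr (M+1) := (le_abs_self _).trans_lt a1
    have a8 : 0 ≤ μ (M+1) := (slr_pos M).le.trans a6
    set z := Real.sqrt (μ (M+1)) with hzz
    have z2 : z ^ 2 = μ (M+1) := Real.sq_sqrt a8
    have z0 : 0 ≤ z := Real.sqrt_nonneg _
    have zl : (M:ℝ) + 1/2 ≤ z := by
      rw [← z2, slr] at a6
      exact (pow_le_pow_iff_left₀ (by positivity) z0 two_ne_zero).1 a6
    have zu : z < (M:ℝ) + 1 + 1/2 := by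
      rw [← z2, slr] at a7
      have := (pow_lt_pow_iff_left₀ z0 (by positivity) two_ne_zero).1 a7
      push_cast at this; exact this
    have hF0 : F ((z:ℂ) ^ 2) = 0 := (hz _).2 ⟨M+1, by rw [← Complex.ofReal_pow, z2]⟩
    have hb := hAs z (by rw [Complex.norm_real, Real.norm_of_nonneg z0]; linarith)
    rw [hF0, zero_add, norm_mul, Complex.norm_real, Real.norm_of_nonneg z0] at hb
    simp only [Complex.ofReal_im, abs_zero, mul_zero, Real.exp_zero, mul_one] at hb
    rw [← Complex.ofReal_mul, ← Complex.ofReal_sin, Complex.norm_real, Real.norm_eq_abs] at hb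
    have hsin : |Real.sin (π * z)| = |Real.sin (π * (z - ((M+1:ℕ):ℝ)))| := by
      have : π * (z - ((M+1:ℕ):ℝ)) = π * z - ((M+1:ℕ):ℝ) * π := by ring
      rw [this, Real.sin_sub_nat_mul_pi, abs_mul, abs_pow, abs_neg, abs_one, one_pow, one_mul]
    have ht : |z - ((M+1:ℕ):ℝ)| ≤ 1/2 := by
      rw [abs_le]; push_cast; constructor <;> linarith
    have hj := sl_sin_jordan ht
    rw [← hsin] at hj
    have e : μ (M+1) - ((M+1 : ℕ):ℝ) ^ 2 = (z - ((M+1:ℕ):ℝ)) * (z + ((M+1:ℕ):ℝ)) := by rw [← z2]; ring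
    rw [e, abs_mul, abs_of_nonneg (by positivity : 0 ≤ z + ((M+1:ℕ):ℝ))]
    have h3 : z + ((M+1:ℕ):ℝ) ≤ 4 * z := by push_cast; linarith
    have h4 := abs_nonneg (z - ((M+1:ℕ):ℝ))
    have h5 := mul_le_mul_of_nonneg_left hj z0
    have h6 := mul_le_mul_of_nonneg_left h3 h4
    nlinarith
  set K := max N0 ⌈Z⌉₊ with hK
  refine ⟨2 * C + ∑ k ∈ Finset.range (K+1), |μ k - (k:ℝ) ^ 2|,
    add_nonneg (by positivity) (Finset.sum_nonneg (fun _ _ => abs_nonneg _)), fun k => ?_⟩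
  rcases lt_or_ge k (K+1) with h | h
  · have := Finset.single_le_sum (f := fun k : ℕ => |μ k - (k:ℝ) ^ 2|) (fun _ _ => abs_nonneg _) (Finset.mem_range.2 h)
    linarith
  · obtain ⟨M, rfl⟩ : ∃ M, k = M + 1 := ⟨k - 1, by omega⟩
    have h1 := key M (by omega)
    have := Finset.sum_nonneg (s := Finset.range (K+1)) (f := fun k : ℕ => |μ k - (k:ℝ) ^ 2|) (fun _ _ => abs_nonneg _)
    linarith

open Filter Topology in
lemma sl_harm (D : ℝ) : Tendsto (fun N : ℕ => ∑ k ∈ Finset.range (N+1), D / (slr N - (k:ℝ) ^ 2)) atTop (𝓝 0) := by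
  have h1 : Tendsto (fun j : ℕ => 2 * |D| * (1 / ((j:ℝ) + 1/2))) atTop (𝓝 0) := by
    have : Tendsto (fun j : ℕ => (1 / ((j:ℝ) + 1/2))) atTop (𝓝 0) := by
      simp only [one_div]
      exact (tendsto_natCast_atTop_atTop.atTop_add tendsto_const_nhds).inv_tendsto_atTop
    simpa using this.const_mul (2 * |D|)
  have h2 := (h1.cesaro).comp (tendsto_add_atTop_nat 1)
  apply squeeze_zero_norm _ h2
  intro N
  refine (norm_sum_le _ _).trans ?_
  simp only [Function.comp]
  rw [← Finset.sum_range_reflect, Finset.mul_sum]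
  apply Finset.sum_le_sum
  intro j hj
  have hj' : j ≤ N := Nat.lt_succ_iff.1 (Finset.mem_range.1 hj)
  have hjr : (j:ℝ) ≤ N := by exact_mod_cast hj'
  have e : ((N + 1 - 1 - j : ℕ) : ℝ) = N - j := by
    rw [Nat.add_sub_cancel, Nat.cast_sub hj']
  rw [e]
  have hj0 : (0:ℝ) ≤ j := Nat.cast_nonneg j
  have hN0 : (0:ℝ) ≤ N := Nat.cast_nonneg N
  have hp : slr N - ((N:ℝ) - j) ^ 2 = ((j:ℝ) + 1/2) * (2 * N - j + 1/2) := by rw [slr]; ring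
  have hp2 : 0 < 2 * (N:ℝ) - j + 1/2 := by linarith
  rw [hp, norm_div, Real.norm_eq_abs, Real.norm_of_nonneg (by positivity)]
  push_cast
  rw [← div_eq_inv_mul, mul_one_div, div_div, div_le_div_iff₀ (by positivity) (by positivity)]
  have : ((j:ℝ) + 1/2) * (N + 1) ≤ 2 * (((j:ℝ) + 1/2) * (2 * N - j + 1/2)) := by nlinarith
  nlinarith [abs_nonneg D]

open Filter Topology in
lemma sl_T {F : ℂ → ℂ} (hA : SlAs F) {μ : ℕ → ℝ} {D : ℝ}
    (hD : ∀ k : ℕ, |μ k - (k:ℝ) ^ 2| ≤ D) :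
    ∃ ε : ℕ → ℝ, Tendsto ε atTop (𝓝 0) ∧ ∃ N1 : ℕ, ∀ N ≥ N1, ∀ g g0 : ℂ → ℂ,
      Differentiable ℂ g → Differentiable ℂ g0 →
      (∀ l, F l = (∏ k ∈ Finset.range (N+1), ((μ k : ℂ) - l)) * g l) →
      (∀ l, slZ l = (∏ k ∈ Finset.range (N+1), ((k:ℂ) ^ 2 - l)) * g0 l) →
      (∀ l ∈ Metric.closedBall (0:ℂ) (slr N), g l ≠ 0) →
      ∀ l ∈ Metric.closedBall (0:ℂ) (slr N), ‖g0 l / g l - 1‖ ≤ ε N := by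
  obtain ⟨C, hC, N0, hN0⟩ := sl_circle hA
  set δ : ℕ → ℝ := fun N => Real.exp (∑ k ∈ Finset.range (N+1), D / (slr N - (k:ℝ) ^ 2)) - 1 with hδ
  have hδ0 : Tendsto δ atTop (𝓝 0) := by
    have := (Real.continuous_exp.tendsto 0).comp (sl_harm D)
    simpa [hδ, Function.comp_def] using this.sub_const 1
  have hη0 : Tendsto (fun N : ℕ => 2 * (C / ((N:ℝ) + 1/2))) atTop (𝓝 0) := by
    have : Tendsto (fun j : ℕ => (1 / ((j:ℝ) + 1/2))) atTop (𝓝 0) := by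
      simp only [one_div]
      exact (tendsto_natCast_atTop_atTop.atTop_add tendsto_const_nhds).inv_tendsto_atTop
    have := this.const_mul (2 * C)
    simp only [mul_zero] at this
    refine this.congr (fun N => by ring)
  refine ⟨fun N => 2 * (C / ((N:ℝ) + 1/2)) * (1 + δ N) + δ N, ?_, max N0 ⌈2 * C⌉₊, ?_⟩
  · simpa using (hη0.mul (hδ0.const_add 1)).add hδ0
  intro N hN g g0 hg hg0 he he0 hgn
  have hN1 : N0 ≤ N := (le_max_left _ _).trans hN
  have hN2 : 2 * C ≤ N := Nat.ceil_le.1 ((le_max_right _ _).trans hN)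
  have hcl : ∀ l ∈ Metric.sphere (0:ℂ) (slr N), ‖g0 l / g l - 1‖ ≤ 2 * (C / ((N:ℝ) + 1/2)) * (1 + δ N) + δ N := by
    intro l hl
    have hln : ‖l‖ = slr N := by simpa using hl
    have hgl := hgn l (Metric.sphere_subset_closedBall hl)
    have hZ := slZ_circle N l hln
    have hw := hN0 N hN1 l hln
    set w := F l / slZ l with hwd
    have hη : C / ((N:ℝ) + 1/2) ≤ 1/2 := by
      rw [div_le_iff₀ (by positivity)]; linarith
    have hwn : 1/2 ≤ ‖w‖ := by
      have := norm_sub_norm_le (1:ℂ) w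
      rw [norm_one, norm_sub_rev] at this
      linarith
    have hw0 : w ≠ 0 := by rw [← norm_pos_iff]; linarith
    have hFl : F l ≠ 0 := fun h => hw0 (by rw [hwd, h, zero_div])
    have hwi : ‖w⁻¹ - 1‖ ≤ 2 * (C / ((N:ℝ) + 1/2)) := by
      have : w⁻¹ - 1 = (1 - w) / w := by field_simp
      rw [this, norm_div, norm_sub_rev, div_le_iff₀ (by linarith)]
      have : 0 ≤ C / ((N:ℝ) + 1/2) := by positivity
      nlinarith
    have hk : ∀ k ∈ Finset.range (N+1), (0:ℝ) < slr N - (k:ℝ) ^ 2 ∧ slr N - (k:ℝ) ^ 2 ≤ ‖(k:ℂ) ^ 2 - l‖ := by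
      intro k hk
      have h1 := (sl_sq_lt N k).2 (Nat.lt_succ_iff.1 (Finset.mem_range.1 hk))
      refine ⟨by linarith, ?_⟩
      have := norm_sub_norm_le l ((k:ℂ) ^ 2)
      rw [norm_sub_rev] at this
      simpa [hln] using this
    set f : ℕ → ℂ := fun k => ((μ k : ℂ) - (k:ℂ) ^ 2) / ((k:ℂ) ^ 2 - l) with hf
    have hprod := Finset.norm_prod_one_add_sub_one_le (Finset.range (N+1)) f
    have hfk : ∀ k ∈ Finset.range (N+1), ‖f k‖ ≤ D / (slr N - (k:ℝ) ^ 2) := by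
      intro k hk'
      obtain ⟨k1, k2⟩ := hk k hk'
      have h0 := hD k
      rw [hf, norm_div]
      have : ‖(μ k : ℂ) - (k:ℂ) ^ 2‖ = |μ k - (k:ℝ) ^ 2| := by
        rw [← Real.norm_eq_abs, ← Complex.norm_real]; push_cast; rfl
      rw [this]
      exact div_le_div₀ ((abs_nonneg _).trans h0) h0 k1 k2
    have hp : ‖∏ k ∈ Finset.range (N+1), (1 + f k) - 1‖ ≤ δ N := by
      refine hprod.trans ?_
      rw [hδ]
      have := Real.exp_le_exp.2 (Finset.sum_le_sum hfk)
      linarith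
    set p := ∏ k ∈ Finset.range (N+1), (1 + f k) with hpd
    have hpe : p * (∏ k ∈ Finset.range (N+1), ((k:ℂ) ^ 2 - l)) = ∏ k ∈ Finset.range (N+1), ((μ k : ℂ) - l) := by
      rw [hpd, ← Finset.prod_mul_distrib]
      refine Finset.prod_congr rfl (fun k hk' => ?_)
      have hne : (k:ℂ) ^ 2 - l ≠ 0 := by
        obtain ⟨k1, k2⟩ := hk k hk'
        rw [← norm_pos_iff]; linarith
      rw [hf]; field_simp; ring
    have hq0 : (∏ k ∈ Finset.range (N+1), ((k:ℂ) ^ 2 - l)) ≠ 0 := by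
      intro h; apply hZ; rw [he0, h, zero_mul]
    have hT : g0 l / g l = w⁻¹ * p := by
      rw [hwd, inv_div, div_mul_eq_mul_div, div_eq_div_iff hgl hFl, he, he0, ← hpe]; ring
    have : g0 l / g l - 1 = (w⁻¹ - 1) * p + (p - 1) := by rw [hT]; ring
    rw [this]
    refine (norm_add_le _ _).trans ?_
    rw [norm_mul]
    have hpn : ‖p‖ ≤ 1 + δ N := by
      have := norm_sub_norm_le p 1
      rw [norm_one] at this; linarith
    have := mul_le_mul hwi hpn (norm_nonneg _) (by positivity)
    linarith
  intro l hl
  have hr := slr_pos N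
  rw [← closure_ball (0:ℂ) hr.ne'] at hl
  have hdc : DiffContOnCl ℂ (fun l => g0 l / g l - 1) (Metric.ball (0:ℂ) (slr N)) := by
    apply DifferentiableOn.diffContOnCl
    rw [closure_ball (0:ℂ) hr.ne']
    intro x hx
    exact ((hg0 x).fun_div (hg x) (hgn x hx)).sub_const 1 |>.differentiableWithinAt
  refine Complex.norm_le_of_forall_mem_frontier_norm_le Metric.isBounded_ball hdc ?_ hl
  rw [frontier_ball (0:ℂ) hr.ne']
  exact hcl

lemma sl_euler (N : ℕ) {g0 : ℂ → ℂ} (hg0 : Differentiable ℂ g0)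
    (he0 : ∀ l, slZ l = (∏ k ∈ Finset.range (N+1), ((k:ℂ) ^ 2 - l)) * g0 l) (z : ℂ) :
    (∏ j ∈ Finset.range N, ((j:ℂ) + 1) ^ 2) * g0 (z ^ 2) =
      π * ((∫ x in (0:ℝ)..π/2, ((Real.cos x : ℝ) : ℂ) ^ (2 * N) * Complex.cos (2 * z * x))
        / ((∫ x in (0:ℝ)..π/2, Real.cos x ^ (2 * N) : ℝ) : ℂ)) := by
  have hc1 : Continuous (fun z : ℂ => (∏ j ∈ Finset.range N, ((j:ℂ) + 1) ^ 2) * g0 (z ^ 2)) := by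
    have := hg0.continuous
    fun_prop
  have hc2 : Continuous (fun z : ℂ => (π : ℂ) * ((∫ x in (0:ℝ)..π/2, ((Real.cos x : ℝ) : ℂ) ^ (2 * N) * Complex.cos (2 * z * x))
        / ((∫ x in (0:ℝ)..π/2, Real.cos x ^ (2 * N) : ℝ) : ℂ))) := by
    apply Continuous.mul continuous_const
    apply Continuous.div_const
    apply intervalIntegral.continuous_parametric_intervalIntegral_of_continuous'
    fun_prop
  have hden : Dense ((range (fun m : ℤ => (m : ℂ)))ᶜ) := (countable_range _).dense_compl ℂ
  refine congrFun (Continuous.ext_on hden hc1 hc2 ?_) z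
  intro z hz
  have hzi : ∀ m : ℤ, z ≠ m := fun m h => hz ⟨m, h.symm⟩
  have hz0 : z ≠ 0 := by simpa using hzi 0
  have h1 := he0 (z ^ 2)
  rw [slZ_sq, EulerSine.sin_pi_mul_eq z N, Finset.prod_range_succ'] at h1
  have h2 : ∏ j ∈ Finset.range N, (((j + 1 : ℕ) : ℂ) ^ 2 - z ^ 2)
      = (∏ j ∈ Finset.range N, ((j:ℂ) + 1) ^ 2) * ∏ j ∈ Finset.range N, (1 - z ^ 2 / ((j:ℂ) + 1) ^ 2) := by
    rw [← Finset.prod_mul_distrib]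
    refine Finset.prod_congr rfl (fun j _ => ?_)
    have : (j:ℂ) + 1 ≠ 0 := Nat.cast_add_one_ne_zero j
    push_cast; field_simp
  have hP : ∏ j ∈ Finset.range N, (1 - z ^ 2 / ((j:ℂ) + 1) ^ 2) ≠ 0 := by
    rw [Finset.prod_ne_zero_iff]
    intro j _ h
    have hj : (j:ℂ) + 1 ≠ 0 := Nat.cast_add_one_ne_zero j
    have h3 : z ^ 2 = ((j:ℂ) + 1) ^ 2 := by
      field_simp at h
      linear_combination -h
    rcases sq_eq_sq_iff_eq_or_eq_neg.1 h3 with h4 | h4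
    · exact hzi (j+1) (by rw [h4]; push_cast; ring)
    · exact hzi (-(j+1)) (by rw [h4]; push_cast; ring)
  have hcomm : (∫ x in (0:ℝ)..π/2, ((Real.cos x : ℝ) : ℂ) ^ (2 * N) * Complex.cos (2 * z * x))
     = ∫ x in (0:ℝ)..π/2, Complex.cos (2 * z * x) * ((Real.cos x : ℝ) : ℂ) ^ (2 * N) := by
    congr 1; ext x; ring
  rw [h2] at h1
  simp only
  rw [hcomm]
  apply mul_left_cancel₀ (mul_ne_zero (pow_ne_zero 2 hz0) hP)
  simp only [Nat.cast_zero] at h1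
  linear_combination h1


lemma sl_fin_prod (μ : ℕ → ℝ) {n N : ℕ} (hn : 1 ≤ n) (hnN : n ≤ N) :
    ∏ k ∈ (Finset.range (N+1)).erase n, (μ k - μ n) =
      (μ 0 - μ n) / (n:ℝ) ^ 2 * (∏ k ∈ Finset.range (N+1),
        (if k = 0 ∨ k = n then 1 else (μ k - μ n) / (k : ℝ) ^ 2)) * ∏ j ∈ Finset.range N, ((j:ℝ) + 1) ^ 2 := by
  have hc : ∏ j ∈ Finset.range N, ((j:ℝ) + 1) ^ 2
      = ∏ k ∈ Finset.range (N+1), (if k = 0 then (1:ℝ) else (k:ℝ) ^ 2) := by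
    rw [Finset.prod_range_succ']; simp
  have hn0 : (n:ℝ) ≠ 0 := by exact_mod_cast (by omega : n ≠ 0)
  rw [hc, mul_assoc, ← Finset.prod_mul_distrib]
  have hm : n ∈ Finset.range (N+1) := by rw [Finset.mem_range]; omega
  have h0 : 0 ∈ (Finset.range (N+1)).erase n := by
    rw [Finset.mem_erase, Finset.mem_range]; omega
  rw [← Finset.mul_prod_erase _ _ hm, ← Finset.mul_prod_erase _ _ h0, ← Finset.mul_prod_erase _ _ h0]
  have e : ∏ x ∈ ((Finset.range (N+1)).erase n).erase 0,
      ((if x = 0 ∨ x = n then 1 else (μ x - μ n) / (x : ℝ) ^ 2) * (if x = 0 then (1:ℝ) else (x:ℝ) ^ 2))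
      = ∏ x ∈ ((Finset.range (N+1)).erase n).erase 0, (μ x - μ n) := by
    refine Finset.prod_congr rfl (fun x hx => ?_)
    rw [Finset.mem_erase, Finset.mem_erase] at hx
    have hx0 : (x:ℝ) ≠ 0 := by exact_mod_cast hx.1
    rw [if_neg (by tauto), if_neg hx.1]
    field_simp
  rw [e]
  have : n ≠ 0 := by omega
  simp [this]
  field_simp

lemma sl_multip {μ : ℕ → ℝ} {D : ℝ} (hD0 : 0 ≤ D) (hD : ∀ k : ℕ, |μ k - (k:ℝ) ^ 2| ≤ D) (n : ℕ) :
    Multipliable (fun k : ℕ => if k = 0 ∨ k = n then 1 else (μ k - μ n) / (k : ℝ) ^ 2) := by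
  have e : (fun k : ℕ => if k = 0 ∨ k = n then 1 else (μ k - μ n) / (k : ℝ) ^ 2)
     = fun k : ℕ => 1 + (if k = 0 ∨ k = n then 0 else (μ k - (k:ℝ) ^ 2 - μ n) / (k : ℝ) ^ 2) := by
    ext k
    split_ifs with h
    · simp
    · have : (k:ℝ) ≠ 0 := by
        have : k ≠ 0 := by tauto
        exact_mod_cast this
      field_simp; ring
  rw [e]
  apply multipliable_one_add_of_summable
  have hs : Summable (fun k : ℕ => (D + |μ n|) * (1 / (k:ℝ) ^ 2)) :=
    (Real.summable_one_div_nat_pow.2 one_lt_two).mul_left _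
  refine Summable.of_nonneg_of_le (fun k => norm_nonneg _) (fun k => ?_) hs
  split_ifs with h
  · rw [norm_zero]; positivity
  · rw [norm_div, mul_one_div, Real.norm_eq_abs, Real.norm_of_nonneg (by positivity : (0:ℝ) ≤ (k:ℝ)^2)]
    gcongr
    exact (abs_sub _ _).trans (by linarith [hD k])

open Filter Topology in
lemma sl_main {F : ℂ → ℂ} (hF : Differentiable ℂ F) (hA : SlAs F) {μ : ℕ → ℝ} (hm : StrictMono μ)
    (hz : ∀ l, F l = 0 ↔ ∃ k, l = (μ k : ℂ)) (hs : ∀ l, F l = 0 → deriv F l ≠ 0) {n : ℕ} (hn : 1 ≤ n) :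
    Multipliable (fun k : ℕ => if k = 0 ∨ k = n then 1 else (μ k - μ n) / (k : ℝ) ^ 2) ∧
    deriv F (μ n) = ((-((μ 0 - μ n) / (n:ℝ) ^ 2 *
      (∏' k : ℕ, (if k = 0 ∨ k = n then 1 else (μ k - μ n) / (k : ℝ) ^ 2)) * π) : ℝ) : ℂ) := by
  obtain ⟨D, hD0, hD⟩ := sl_loc hF hA hm hz hs
  obtain ⟨N0, hN0⟩ := sl_count hF hA hm hz hs
  obtain ⟨ε, hε, N1, hN1⟩ := sl_T hA hD
  have hM := sl_multip hD0 hD n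
  refine ⟨hM, ?_⟩
  obtain ⟨z, hzz⟩ := IsAlgClosed.exists_pow_nat_eq (μ n : ℂ) two_pos
  set f : ℕ → ℝ := fun k : ℕ => if k = 0 ∨ k = n then 1 else (μ k - μ n) / (k : ℝ) ^ 2 with hf
  set e : ℕ → ℂ := fun N => π * ((∫ x in (0:ℝ)..π/2, ((Real.cos x : ℝ) : ℂ) ^ (2 * N) * Complex.cos (2 * z * x))
        / ((∫ x in (0:ℝ)..π/2, Real.cos x ^ (2 * N) : ℝ) : ℂ)) with he
  have hel : Tendsto e atTop (𝓝 (π:ℂ)) := by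
    have h1 := EulerSine.tendsto_integral_cos_pow_mul_div (f := fun x : ℝ => Complex.cos (2 * z * x))
      (by fun_prop)
    have h2 : Tendsto (fun N : ℕ => 2 * N) atTop atTop := tendsto_id.const_mul_atTop' two_pos
    have h3 := (h1.comp h2).const_mul (π:ℂ)
    simpa [he] using h3
  have hpl : Tendsto (fun N : ℕ => ∏ k ∈ Finset.range (N+1), f k) atTop (𝓝 (∏' k, f k)) :=
    hM.hasProd.tendsto_prod_nat.comp (tendsto_add_atTop_nat 1)
  set c : ℝ := (μ 0 - μ n) / (n:ℝ) ^ 2 with hc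
  set G : ℕ → ℂ := fun N => ((c * (∏ k ∈ Finset.range (N+1), f k) : ℝ) : ℂ) * e N with hG
  have hG1 : Tendsto G atTop (𝓝 (((c * (∏' k, f k) : ℝ) : ℂ) * π)) :=
    ((Complex.continuous_ofReal.tendsto _).comp (hpl.const_mul c)).mul hel
  have hG2 : Tendsto G atTop (𝓝 (- deriv F (μ n))) := by
    rw [tendsto_iff_norm_sub_tendsto_zero]
    have hb : Tendsto (fun N => ‖deriv F (μ n)‖ * ε N) atTop (𝓝 0) := by simpa using hε.const_mul ‖deriv F (μ n)‖
    refine tendsto_of_tendsto_of_tendsto_of_le_of_le' tendsto_const_nhds hb (Eventually.of_forall (fun _ => norm_nonneg _)) ?_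
    obtain ⟨C, hC, N2, hN2⟩ := sl_circle hA
    filter_upwards [eventually_ge_atTop N0, eventually_ge_atTop N1, eventually_ge_atTop n,
      eventually_ge_atTop N2, eventually_ge_atTop ⌈C⌉₊] with N g0 g1 gn g2 g3
    have ha : Function.Injective (fun k => (μ k : ℂ)) := fun i j h => hm.injective (Complex.ofReal_injective h)
    have hr : ∀ l : ℂ, ‖l‖ = slr N → F l ≠ 0 := by
      intro l hl h0
      have h1 := hN2 N g2 l hl
      have h2 : C ≤ N := Nat.ceil_le.1 g3
      rw [h0] at h1
      simp only [zero_div, zero_sub, norm_neg, norm_one] at h1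
      rw [le_div_iff₀ (by positivity)] at h1
      linarith
    obtain ⟨g, hg, hge, hgn⟩ := sl_factor_ball hF ha hz hs hr (Finset.range (N+1)) (fun k => by
      rw [Complex.norm_real, Real.norm_eq_abs, hN0 N g0, Finset.mem_range, Nat.lt_succ_iff])
    obtain ⟨h, hh, hhe, hhn⟩ := slZ_factor N
    have hmem : (μ n : ℂ) ∈ Metric.closedBall (0:ℂ) (slr N) := by
      have := (hN0 N g0 n).2 gn
      simpa using this.le
    have hT := hN1 N g1 g h hg hh hge hhe hgn _ hmem
    have hE := sl_euler N hh hhe z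
    rw [hzz] at hE
    have hd := sl_factor_deriv hg hge (Finset.mem_range.2 (Nat.lt_succ_iff.2 gn))
    have hfp := congrArg (fun x : ℝ => (x : ℂ)) (sl_fin_prod μ hn gn)
    have hfp' : ∏ k ∈ (Finset.range (N+1)).erase n, ((μ k : ℂ) - μ n)
      = ((c * (∏ k ∈ Finset.range (N+1), f k) : ℝ) : ℂ) * ∏ j ∈ Finset.range N, ((j:ℂ) + 1) ^ 2 := by
      rw [hc, hf]
      simp only [Complex.ofReal_prod, Complex.ofReal_mul, Complex.ofReal_sub, Complex.ofReal_pow, Complex.ofReal_add, Complex.ofReal_natCast, Complex.ofReal_one] at hfp ⊢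
      exact hfp
    have hgl := hgn _ hmem
    have hGN : G N = - (deriv F (μ n) * (h (μ n) / g (μ n))) := by
      simp only [hG, he]
      rw [← hE, hd, hfp']
      field_simp
    have : G N - -deriv F (μ n) = - (deriv F (μ n) * (h (μ n) / g (μ n) - 1)) := by rw [hGN]; ring
    rw [this, norm_neg, norm_mul]
    exact mul_le_mul_of_nonneg_left hT (norm_nonneg _)
  have := tendsto_nhds_unique hG1 hG2
  rw [← neg_eq_iff_eq_neg] at this
  rw [← this]; push_cast; ring


theorem statement14 (q : ℝ → ℝ) (hq : IntegrableOn q (Set.Icc (0 : ℝ) π))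
    (α β : ℝ) (hα : α ∈ Set.Ioo (0 : ℝ) π) (hβ : β ∈ Set.Ioo (0 : ℝ) π)
    (μ : ℕ → ℝ) (hmono : StrictMono μ)
    (henum : ∀ lam : ℝ, IsEigenvalue q α β lam ↔ ∃ n : ℕ, μ n = lam)
    (Φ Φ' Ψ Ψ' : ℕ → ℝ → ℝ)
    (hΦ : ∀ n : ℕ, IsSol q (μ n) (Φ n) (Φ' n))
    (hΦ0 : ∀ n : ℕ, Φ n 0 = 1) (hΦ'0 : ∀ n : ℕ, Φ' n 0 = -Real.cot α)
    (hΨ : ∀ n : ℕ, IsSol q (μ n) (Ψ n) (Ψ' n))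
    (hΨπ : ∀ n : ℕ, Ψ n π = 1) (hΨ'π : ∀ n : ℕ, Ψ' n π = -Real.cot β)
    (a b : ℕ → ℝ)
    (ha : ∀ n : ℕ, a n = ∫ x in (0 : ℝ)..π, (Φ n x) ^ 2)
    (hb : ∀ n : ℕ, b n = ∫ x in (0 : ℝ)..π, (Ψ n x) ^ 2) :
    ∀ n : ℕ, 1 ≤ n →
      Multipliable (fun k : ℕ =>
        if k = 0 ∨ k = n then 1 else (μ k - μ n) / (k : ℝ) ^ 2) ∧
      1 / b n = a n * (n : ℝ) ^ 4
        / (π ^ 2 * (μ 0 - μ n) ^ 2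
            * (∏' k : ℕ, (if k = 0 ∨ k = n then 1 else (μ k - μ n) / (k : ℝ) ^ 2)) ^ 2) := by
  intro n hn
  have hqi : IntervalIntegrable q volume 0 π :=
    (intervalIntegrable_iff_integrableOn_Icc_of_le pi_pos.le).2 hq
  have hqc : IntervalIntegrable (slC q) volume 0 π := ⟨hqi.1.ofReal, hqi.2.ofReal⟩
  set h : ℝ := -Real.cot α with hh
  set H : ℝ := Real.cot β with hH
  have hz : ∀ l : ℂ, slW (slC q) hqc h H l = 0 ↔ ∃ k, l = (μ k : ℂ) := by
    intro l
    constructor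
    · intro hl
      have hr := slW_zero_real q hqc h H l hl
      rw [hr] at hl
      obtain ⟨k, hk⟩ := (henum _).1 ((sl_eig_iff hqc hα hβ _).2 hl)
      exact ⟨k, by rw [hk]; exact hr⟩
    · rintro ⟨k, rfl⟩
      exact (sl_eig_iff hqc hα hβ _).1 ((henum _).2 ⟨k, rfl⟩)
  have hsimple : ∀ l : ℂ, slW (slC q) hqc h H l = 0 → deriv (slW (slC q) hqc h H) l ≠ 0 :=
    fun l => slW_deriv_ne q hqc h H l
  obtain ⟨hM, hd⟩ := sl_main (slW_diff (slC q) hqc h H) (slW_asymp (slC q) hqc h H) hmono hz hsimple hn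
  refine ⟨hM, ?_⟩
  set P := ∏' k : ℕ, (if k = 0 ∨ k = n then 1 else (μ k - μ n) / (k : ℝ) ^ 2) with hP
  have hW : slW (slC q) hqc h H (μ n) = 0 := (hz _).2 ⟨n, rfl⟩
  have hdn := hsimple _ hW
  have hpq := sl_pq hqc (μ n : ℂ)
  have hY : ∀ x ∈ Icc (0:ℝ) π, slY (slC q) hqc h (μ n) x = (Φ n x : ℂ) ∧
      slY' (slC q) hqc h (μ n) x = (Φ' n x : ℂ) := by
    have := ((hΦ n).csol).uniq (slY_csol (slC q) hqc h (μ n)) hpq 1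
      (by rw [slY_zero]; simp [hΦ0]) (by rw [slY'_zero]; simp [hΦ'0])
    simpa using this
  have hWΦ : Φ' n π + H * Φ n π = 0 := by
    have h1 := hW
    rw [slW, (hY π sl_pi_mem).1, (hY π sl_pi_mem).2] at h1
    exact_mod_cast h1
  have hD1 := slW_deriv (slC q) hqc h H (μ n) hW
  rw [(hY π sl_pi_mem).1, hd] at hD1
  have hint : ∫ t in (0:ℝ)..π, slY (slC q) hqc h (μ n) t ^ 2 = ((a n : ℝ) : ℂ) := by
    rw [ha n, ← intervalIntegral.integral_ofReal]
    apply intervalIntegral.integral_congr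
    intro t ht
    rw [uIcc_of_le pi_pos.le] at ht
    simp only
    rw [(hY t ht).1]; push_cast; rfl
  rw [hint] at hD1
  have hA : Φ n π * ((μ 0 - μ n) / (n:ℝ) ^ 2 * P * π) = a n := by
    have : -Φ n π * (-((μ 0 - μ n) / (n:ℝ) ^ 2 * P * π)) = a n := by exact_mod_cast hD1
    linarith
  have g := ((hΦ n).csol).green hpq hpq sl_pi_mem ((hΨ n).csol).1 ((hΨ n).csol).2
  simp only [sub_self, zero_mul, intervalIntegral.integral_zero, hΨπ, hΨ'π, hΦ0, hΦ'0] at g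
  have g' : Φ' n π * 1 - Φ n π * -H - (h * Ψ n 0 - 1 * Ψ' n 0) = 0 := by
    exact_mod_cast g
  have hΨ0 : Ψ' n 0 = Ψ n 0 * h := by linarith
  have hΨΦ : ∀ x ∈ Icc (0:ℝ) π, Ψ n x = Ψ n 0 * Φ n x := by
    intro x hx
    have := (((hΦ n).csol).uniq ((hΨ n).csol) hpq (Ψ n 0 : ℂ) (by simp [hΦ0])
      (by rw [hΨ0, hΦ'0, Complex.ofReal_mul]) x hx).1
    exact_mod_cast this
  have hone : Ψ n 0 * Φ n π = 1 := by rw [← hΨΦ π sl_pi_mem, hΨπ]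
  have hB : b n = Ψ n 0 ^ 2 * a n := by
    rw [ha n, hb n, ← intervalIntegral.integral_const_mul]
    apply intervalIntegral.integral_congr
    intro t ht
    rw [uIcc_of_le pi_pos.le] at ht
    simp only
    rw [hΨΦ t ht]; ring
  set X := (μ 0 - μ n) / (n:ℝ) ^ 2 * P * π with hX
  have hX0 : X ≠ 0 := by
    intro h0
    apply hdn
    rw [hd, h0]; simp
  have hn0 : (n:ℝ) ≠ 0 := by exact_mod_cast (by omega : n ≠ 0)
  have hab : a n * b n = X ^ 2 := by
    rw [hB, ← hA]
    have e : Φ n π * X * (Ψ n 0 ^ 2 * (Φ n π * X)) = (Ψ n 0 * Φ n π) ^ 2 * X ^ 2 := by ring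
    rw [e, hone]; ring
  have hXX : π ^ 2 * (μ 0 - μ n) ^ 2 * P ^ 2 = X ^ 2 * (n:ℝ) ^ 4 := by
    rw [hX]; field_simp
  have hb0 : b n ≠ 0 := by
    intro h0; rw [h0, mul_zero] at hab; exact pow_ne_zero 2 hX0 hab.symm
  have ha0 : a n ≠ 0 := by
    intro h0; rw [h0, zero_mul] at hab; exact pow_ne_zero 2 hX0 hab.symm
  rw [hXX, ← hab]
  field_simp
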